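/- arXiv:math/0104053 — 2 statements merged into one kernel-verified Lean document; each statement's English description precedes it below -/
import Mathlib

section
/- (First variant of the Andrews–Gordon identities) For all integers ν ≥ 1, M ≥ 0, and all complex q with 0 < |q| < 1: Σ over tuples n = (n_1,…,n_ν) of nonnegative integers of q^{N_1²+⋯+N_ν²−M·N_1} / ((q)_{n_1}(q)_{n_2}⋯(q)_{n_ν}) = Σ over integers s with 1 ≤ s ≤ 2ν+2 and M ≢ ν + s (mod 2) of B^ν_{s,ν+1}(M,1/q) / ∏_{j ≥ 1, j ≢ 0, ±s (mod 2ν+3)} (1−q^j). -/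
open scoped Classical

noncomputable section

/-- The q-Pochhammer symbol `(q)_n = ∏_{j=1}^n (1 - q^j)`. -/
def qP {F : Type*} [Field F] (q : F) (n : ℕ) : F :=
  ∏ j ∈ Finset.range n, (1 - q ^ (j + 1))

/-- The q-binomial coefficient `[N choose k]_q = (q)_N / ((q)_k (q)_{N-k})`
for `0 ≤ k ≤ N`, and `0` otherwise. -/
def qB {F : Type*} [Field F] (q : F) (N k : ℤ) : F :=
  if 0 ≤ k ∧ k ≤ N then qP q N.toNat / (qP q k.toNat * qP q (N - k).toNat) else 0

/-- `NN n i = N_i = n_i + n_{i+1} + ⋯ + n_ν` (indices 1-based; `n ⟨k⟩` is `n_{k+1}`). -/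
def NN {ν : ℕ} (n : Fin ν → ℕ) (i : ℕ) : ℕ :=
  ∑ k : Fin ν, if i ≤ (k : ℕ) + 1 then n k else 0

/-- `α_{i,s} = max(0, i - s)`. -/
def alph (i s : ℕ) : ℤ := max 0 ((i : ℤ) - s)

/-- The exponent `N_1² + ⋯ + N_ν² + N_{s+1} + ⋯ + N_ν`. -/
def expAG (ν s : ℕ) (nn : Fin ν → ℕ) : ℕ :=
  (∑ i ∈ Finset.Icc 1 ν, (NN nn i) ^ 2) + ∑ i ∈ Finset.Icc (s + 1) ν, NN nn i

/-- The polynomial `B^ν_{s,b}(L,q)` of Foda–Quano–Kirillov type. -/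
def B {F : Type*} [Field F] (ν : ℕ) (s b : ℤ) (L : ℕ) (q : F) : F :=
  ∑ᶠ j : ℤ,
    (q ^ (j * ((2 * j + 1) * (2 * (ν : ℤ) + 3) - 2 * s)) *
        qB q (L : ℤ) (((L : ℤ) + b - s) / 2 + j * (2 * (ν : ℤ) + 3)) -
      q ^ ((2 * j + 1) * ((2 * (ν : ℤ) + 3) * j + s)) *
        qB q (L : ℤ) (((L : ℤ) + b + s) / 2 + j * (2 * (ν : ℤ) + 3)))

/-- `jjf j l = j_l` for `1 ≤ l ≤ ν` (and junk value `0` otherwise). -/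
def jjf {ν : ℕ} (j : Fin ν → ℕ) (l : ℕ) : ℤ :=
  if h : l - 1 < ν then (j ⟨l - 1, h⟩ : ℤ) else 0

/-- The q-multinomial coefficient `[L choose a]^(p)_ν`. -/
def qMulti {F : Type*} [Field F] (ν L : ℕ) (a : ℤ) (p : ℕ) (q : F) : F :=
  ∑ᶠ j : Fin ν → ℕ,
    if (∑ l, (j l : ℤ)) = a then
      q ^ ((∑ l ∈ Finset.Icc 2 ν, jjf j (l - 1) * ((L : ℤ) - jjf j l)) -
            ∑ l ∈ Finset.Icc 1 p, jjf j l) *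
        qB q (L : ℤ) (jjf j ν) * ∏ l ∈ Finset.Icc 2 ν, qB q (jjf j l) (jjf j (l - 1))
    else 0

/-- The polynomial `W^ν_{s,b}(L,q)` of Warnaar type. -/
def W {F : Type*} [Field F] (ν : ℕ) (s : ℤ) (b L : ℕ) (q : F) : F :=
  ∑ᶠ j : ℤ,
    (q ^ (j * ((2 * j + 1) * (2 * (ν : ℤ) + 3) - 2 * s)) *
        qMulti ν L (((ν : ℤ) * ((L : ℤ) + 1) - s - b + 1) / 2 + (2 * (ν : ℤ) + 3) * j) b q -
      q ^ ((2 * j + 1) * ((2 * (ν : ℤ) + 3) * j + s)) *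
        qMulti ν L (((ν : ℤ) * ((L : ℤ) + 1) + s - b + 1) / 2 + (2 * (ν : ℤ) + 3) * j) b q)

/-! ### Bressoud lattice paths -/

/-- Step values: `0 ↦ NE (+1)`, `1 ↦ SE (−1)`, `2 ↦ horizontal (0)`. -/
def stepVal : Fin 3 → ℤ := ![1, -1, 0]

/-- Height of the path after `k` steps, starting at height `s`. -/
def hts (s : ℤ) {n : ℕ} (d : Fin n → Fin 3) (k : ℕ) : ℤ :=
  s + ∑ i ∈ Finset.range k, if h : i < n then stepVal (d ⟨i, h⟩) else 0

/-- The vertex `k` is a peak: it is preceded by a NE step and followed by a SE step. -/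
def IsPeak {n : ℕ} (d : Fin n → Fin 3) (k : ℕ) : Prop :=
  ∃ hk : k < n, 1 ≤ k ∧ d ⟨k - 1, Nat.lt_of_le_of_lt (Nat.sub_le k 1) hk⟩ = 0 ∧ d ⟨k, hk⟩ = 1

/-- `d` encodes a Bressoud path from height `s` to height `b` whose peaks have height `≤ ν`:
SE steps only from positive height, horizontal steps only on the x-axis. -/
def ValidPath (ν : ℕ) (s b : ℤ) {n : ℕ} (d : Fin n → Fin 3) : Prop :=
  hts s d n = b ∧
    (∀ k : Fin n, (d k = 1 → 0 < hts s d (k : ℕ)) ∧ (d k = 2 → hts s d (k : ℕ) = 0)) ∧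
    (∀ k : ℕ, IsPeak d k → hts s d k ≤ (ν : ℤ))

/-- The weight of a Bressoud path starting at x-coordinate `M`:
the sum of the x-coordinates of its peaks. -/
def pwt (M : ℤ) {n : ℕ} (d : Fin n → Fin 3) : ℤ :=
  ∑ k ∈ Finset.range (n + 1), if IsPeak d k then M + (k : ℤ) else 0

/-- `C^ν_{M,L}(s,b,q)`: the weighted count of Bressoud paths from `(M,s)` to `(L,b)`
with no peak higher than `ν`. -/
def Cpoly {F : Type*} [Field F] (ν : ℕ) (M L : ℤ) (s b : ℕ) (q : F) : F :=
  ∑ d ∈ Finset.univ.filter (fun d : Fin (L - M).toNat → Fin 3 => ValidPath ν (s : ℤ) (b : ℤ) d),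
    q ^ pwt M d

/-- `t` is an admissible relative height for the peak at vertex `k`. -/
def RelProp (s : ℤ) {n : ℕ} (d : Fin n → Fin 3) (k t : ℕ) : Prop :=
  0 < t ∧ ∃ k' k'' : ℕ, k' < k ∧ k < k'' ∧ k'' ≤ n ∧
    hts s d k' = hts s d k - t ∧ hts s d k'' = hts s d k - t ∧
    ∀ m : ℕ, k' < m → m < k'' → IsPeak d m →
      hts s d m ≤ hts s d k ∧ (hts s d m = hts s d k → k ≤ m)

/-- The relative height of the peak at vertex `k`: the largest `t` with `RelProp`. -/
def relHt (ν : ℕ) (s : ℤ) {n : ℕ} (d : Fin n → Fin 3) (k : ℕ) : ℕ :=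
  Nat.findGreatest (RelProp s d k) (ν + n)

/-- `P^ν_{M,L}(s,b,n)`: Bressoud paths from `(M,s)` to `(L,b)`, peaks of height at most `ν`,
with exactly `nn j` peaks of relative height `j+1`. -/
def Pset (ν : ℕ) (M L : ℤ) (s b : ℤ) (nn : Fin ν → ℕ) : Finset (Fin (L - M).toNat → Fin 3) :=
  Finset.univ.filter (fun d => ValidPath ν s b d ∧
    ∀ j : Fin ν, ((Finset.range ((L - M).toNat + 1)).filter
      (fun k => IsPeak d k ∧ relHt ν s d k = (j : ℕ) + 1)).card = nn j)

/-! ### Gordon lattice paths -/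

/-- `f` encodes a Gordon path of length `n` from height `s` to height `b`:
`f 0 = s`, `f n = b`, adjacent frequencies sum to at most `ν`; values beyond `n` are `0`. -/
def IsGordon (ν n s b : ℕ) (f : ℕ → ℕ) : Prop :=
  f 0 = s ∧ f n = b ∧ (∀ k, k < n → f k + f (k + 1) ≤ ν) ∧ (∀ k, n < k → f k = 0)

/-- The weight `Σ_{j=M+1}^{L-1} j f_j` of a Gordon path starting at x-coordinate `M`. -/
def gwt (M : ℤ) (n : ℕ) (f : ℕ → ℕ) : ℤ :=
  ∑ k ∈ Finset.Ioo 0 n, (M + (k : ℤ)) * (f k : ℤ)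

/-- `G^ν_{M,L}(s,b,q)`: the weighted count of Gordon paths from `(M,s)` to `(L,b)`. -/
def G {F : Type*} [Field F] (ν : ℕ) (M L : ℤ) (s b : ℕ) (q : F) : F :=
  ∑ᶠ f : ℕ → ℕ, if IsGordon ν (L - M).toNat s b f then q ^ gwt M (L - M).toNat f else 0

/-- `F^ν_{s,b}(L,q)` of (2.21). -/
def Fpoly {F : Type*} [Field F] (ν s b L : ℕ) (q : F) : F :=
  ∑ᶠ nn : Fin ν → ℕ, q ^ expAG ν s nn *
    ∏ i : Fin ν, qB q ((nn i : ℤ) + ((i : ℕ) + 1) * (L : ℤ) -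
      2 * (∑ l ∈ Finset.Icc 1 ((i : ℕ) + 1), (NN nn l : ℤ)) -
      alph ((i : ℕ) + 1) s - alph ((i : ℕ) + 1) b) (nn i)

/-- The left-hand side of (4.2): `F` with the extra `−M(N_1+⋯+N_ν)` in the exponent. -/
def FpolyM {F : Type*} [Field F] (ν s b L M : ℕ) (q : F) : F :=
  ∑ᶠ nn : Fin ν → ℕ,
    q ^ ((expAG ν s nn : ℤ) - (M : ℤ) * ∑ i ∈ Finset.Icc 1 ν, (NN nn i : ℤ)) *
    ∏ i : Fin ν, qB q ((nn i : ℤ) + ((i : ℕ) + 1) * (L : ℤ) -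
      2 * (∑ l ∈ Finset.Icc 1 ((i : ℕ) + 1), (NN nn l : ℤ)) -
      alph ((i : ℕ) + 1) s - alph ((i : ℕ) + 1) b) (nn i)


abbrev K : Type := RatFunc ℚ

section

open Filter Topology

/-- The reciprocal `1/(q)_n`, extended by zero to negative `n`. -/
def iq {F : Type*} [Field F] (q : F) (n : ℤ) : F :=
  if 0 ≤ n then (qP q n.toNat)⁻¹ else 0

lemma iq_neg {F : Type*} [Field F] (q : F) {n : ℤ} (h : n < 0) : iq q n = 0 := by
  simp [iq, not_le.mpr h]

lemma iq_nat {F : Type*} [Field F] (q : F) (n : ℕ) : iq q (n : ℤ) = (qP q n)⁻¹ := by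
  simp [iq]

lemma iq_zero {F : Type*} [Field F] (q : F) : iq q 0 = 1 := by
  simp [iq, qP]

lemma qP_ne_zero {F : Type*} [Field F] {q : F} (hq : ∀ n : ℕ, q ^ (n + 1) ≠ 1) (n : ℕ) :
    qP q n ≠ 0 := by
  unfold qP
  rw [Finset.prod_ne_zero_iff]
  intro j _ h
  exact hq j (sub_eq_zero.mp h).symm

lemma iq_rec {F : Type*} [Field F] {q : F} (hq : ∀ n : ℕ, q ^ (n + 1) ≠ 1) (n : ℤ) :
    iq q (n - 1) = (1 - q ^ n) * iq q n := by
  rcases lt_trichotomy n 0 with h | h | h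
  · rw [iq_neg q h, iq_neg q (by omega), mul_zero]
  · subst h
    rw [iq_neg q (by omega)]; simp
  · obtain ⟨m, rfl⟩ : ∃ m : ℕ, n = ((m + 1 : ℕ) : ℤ) := ⟨(n - 1).toNat, by omega⟩
    have e : ((m + 1 : ℕ) : ℤ) - 1 = (m : ℤ) := by push_cast; ring
    rw [e, iq_nat, iq_nat, zpow_natCast]
    have h1 : qP q (m + 1) = qP q m * (1 - q ^ (m + 1)) := by
      simp [qP, Finset.prod_range_succ]
    rw [h1]
    have h2 : (1 - q ^ (m + 1)) ≠ 0 := fun h => hq m (sub_eq_zero.mp h).symm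
    have h3 := qP_ne_zero hq m
    field_simp

lemma qB_eq {F : Type*} [Field F] (q : F) (N : ℕ) (k : ℤ) :
    qB q (N : ℤ) k = qP q N * iq q k * iq q (N - k) := by
  unfold qB iq
  split_ifs with h1 h2 h3 <;> first | omega | skip
  · simp only [Int.toNat_natCast]
    rw [div_eq_mul_inv, mul_inv, mul_assoc]
  · simp
  · simp

lemma norm_pow_ne_one {q : ℂ} (hq : ‖q‖ < 1) (n : ℕ) : q ^ (n + 1) ≠ 1 := by
  intro h
  have h1 : ‖q‖ ^ (n + 1) = 1 := by rw [← norm_pow, h, norm_one]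
  have := pow_lt_one₀ (norm_nonneg q) hq (Nat.succ_ne_zero n)
  simp only [Nat.succ_eq_add_one] at this
  linarith

lemma inv_pow_ne_one {q : ℂ} (hq : ‖q‖ < 1) (n : ℕ) : (q⁻¹) ^ (n + 1) ≠ 1 := by
  intro h
  rw [inv_pow, inv_eq_one] at h
  exact norm_pow_ne_one hq n h

/-- The infinite product `(q)_∞`. -/
def qInf (q : ℂ) : ℂ := ∏' j : ℕ, (1 - q ^ (j + 1))

lemma summable_pow_succ {q : ℂ} (hq : ‖q‖ < 1) : Summable fun j : ℕ => ‖q ^ (j + 1)‖ := by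
  have := (summable_geometric_of_lt_one (norm_nonneg q) hq)
  simpa [norm_pow] using (summable_nat_add_iff 1).mpr this

lemma qInf_ne_zero {q : ℂ} (hq : ‖q‖ < 1) : qInf q ≠ 0 := by
  unfold qInf
  simp_rw [sub_eq_add_neg]
  refine tprod_one_add_ne_zero_of_summable (f := fun n ↦ -q ^ (n + 1)) ?_ ?_
  · intro i h
    apply norm_pow_ne_one hq i
    linear_combination -h
  · simpa using summable_pow_succ hq

lemma qP_tendsto {q : ℂ} (hq : ‖q‖ < 1) : Tendsto (fun n : ℕ => qP q n) atTop (𝓝 (qInf q)) :=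
  (ModularForm.multipliable_one_sub_pow hq).tendsto_prod_tprod_nat

lemma iq_tendsto_top {q : ℂ} (hq : ‖q‖ < 1) : Tendsto (fun n : ℤ => iq q n) atTop
    (𝓝 (qInf q)⁻¹) := by
  have h1 : Tendsto (fun n : ℤ => (qP q n.toNat)⁻¹) atTop (𝓝 (qInf q)⁻¹) := by
    refine ((qP_tendsto hq).inv₀ (qInf_ne_zero hq)).comp (tendsto_atTop.2 fun b => ?_)
    filter_upwards [eventually_ge_atTop (b : ℤ)] with n hn
    omega
  refine h1.congr' ?_
  filter_upwards [eventually_ge_atTop 0] with n hn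
  simp [iq, hn]

lemma iq_tendsto {q : ℂ} (hq : ‖q‖ < 1) (a : ℤ) :
    Tendsto (fun n : ℕ => iq q ((n : ℤ) + a)) atTop (𝓝 (qInf q)⁻¹) :=
  (iq_tendsto_top hq).comp (tendsto_atTop_add_const_right _ a tendsto_natCast_atTop_atTop)

lemma iq_bdd {q : ℂ} (hq : ‖q‖ < 1) : ∃ C : ℝ, 0 < C ∧ ∀ n : ℤ, ‖iq q n‖ ≤ C := by
  have h := Metric.isBounded_range_of_tendsto _ (iq_tendsto hq 0)
  obtain ⟨C, hC⟩ := h.exists_norm_le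
  refine ⟨max C 1, by positivity, fun n => ?_⟩
  rcases lt_or_ge n 0 with h | h
  · rw [iq_neg q h]; simp
  · obtain ⟨m, rfl⟩ := Int.eq_ofNat_of_zero_le h
    refine le_trans (hC _ ⟨m, by simp⟩) (le_max_left _ _)

lemma summable_abs_int {r : ℝ} (h0 : 0 ≤ r) (h1 : r < 1) :
    Summable fun n : ℤ => r ^ n.natAbs := by
  have := summable_geometric_of_lt_one h0 h1
  apply Summable.of_nat_of_neg <;> simpa using this

lemma sumZ_of {r : ℝ} (h0 : 0 < r) (h1 : r < 1) (e : ℤ → ℤ) (C : ℤ)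
    (h : ∀ n, |n| - C ≤ e n) : Summable fun n : ℤ => r ^ (e n) := by
  refine Summable.of_nonneg_of_le (fun n => by positivity) (fun n => ?_)
    ((summable_abs_int h0.le h1).mul_left (r ^ (-C)))
  have : r ^ n.natAbs = r ^ (|n|) := by
    rw [← zpow_natCast, Int.natCast_natAbs]
  rw [this, ← zpow_add₀ h0.ne']
  apply zpow_le_zpow_right_of_le_one₀ h0 h1.le
  linarith [h n]

lemma quad_bound (c n : ℤ) : |n| - (|c| + 1) ^ 2 ≤ n ^ 2 - c * n := by
  have h1 : c * n ≤ |c| * |n| := by rw [← abs_mul]; exact le_abs_self _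
  have h2 : n ^ 2 = |n| ^ 2 := (sq_abs n).symm
  rw [h2]
  nlinarith [sq_nonneg (|n| - (|c| + 1)), abs_nonneg n, abs_nonneg c, mul_nonneg (abs_nonneg n) (abs_nonneg c)]

/-- triangular numbers -/
def tri (r : ℤ) : ℤ := r * (r - 1) / 2

lemma two_tri (r : ℤ) : 2 * tri r = r * (r - 1) := by
  unfold tri
  have : Even (r * (r - 1)) := Int.even_mul_pred_self r
  exact Int.mul_ediv_cancel' this.two_dvd

lemma tri_succ (r : ℤ) : tri (r + 1) = tri r + r := by
  have h1 := two_tri r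
  have h2 := two_tri (r + 1)
  linarith

lemma tri_pred (r : ℤ) : tri (r - 1) = tri r - r + 1 := by
  have h1 := two_tri r
  have h2 := two_tri (r - 1)
  linarith

lemma tri_neg (r : ℤ) : tri (-r) = tri r + r := by
  have h1 := two_tri r
  have h2 := two_tri (-r)
  linarith

lemma tri_bound (K : ℤ) (hK : 1 ≤ K) (s r : ℤ) :
    |r| - (|K - 2 * s| + 2) ^ 2 ≤ K * tri r + s * r := by
  have h1 := two_tri r
  have h3 : (K - 2 * s) * r ≤ |K - 2 * s| * |r| := by rw [← abs_mul]; exact le_abs_self _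
  have h2 : r * r = |r| ^ 2 := by rw [sq_abs]; ring
  have h4 : 2 * (K * tri r + s * r) = K * |r| ^ 2 - (K - 2 * s) * r := by
    rw [← h2]; linear_combination K * h1
  have h5 : |r| ^ 2 ≤ K * |r| ^ 2 := by nlinarith [sq_nonneg (|r|)]
  nlinarith [sq_nonneg (|r| - (|K - 2 * s| + 2)), abs_nonneg r, abs_nonneg (K - 2 * s),
    mul_nonneg (abs_nonneg r) (abs_nonneg (K - 2 * s))]

lemma tsum_telescope {G : ℤ → ℂ} (hG : Summable G) : ∑' m, (G m - G (m + 1)) = 0 := by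
  have h1 : Summable fun m => G (m + 1) := (Equiv.addRight (1 : ℤ)).summable_iff.mpr hG
  rw [hG.tsum_sub h1]
  have := (Equiv.addRight (1 : ℤ)).tsum_eq G
  simp only [Equiv.coe_addRight] at this
  rw [this, sub_self]

lemma iq_mul_zero {q : ℂ} {x y : ℤ} (h : x < 0 ∨ y < 0) : iq q x * iq q y = 0 := by
  rcases h with h | h <;> simp [iq_neg q h]

lemma summable_icc {f : ℤ → ℂ} (a b : ℤ) (h : ∀ m, m < a ∨ b < m → f m = 0) : Summable f := by
  apply summable_of_ne_finset_zero (s := Finset.Icc a b)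
  intro m hm
  apply h
  rw [Finset.mem_Icc] at hm
  omega

/-- summand of the q-Vandermonde sum -/
def vt (q : ℂ) (n a b m : ℤ) : ℂ :=
  q ^ (m ^ 2 - (a + b) * m) * (iq q (n - m) * iq q (m - a) * iq q (m - b))

lemma vt_summable (q : ℂ) (n a b : ℤ) : Summable (vt q n a b) := by
  apply summable_icc a n
  intro m hm
  unfold vt
  rw [iq_mul_zero (by omega)]; simp

lemma vt_step {q : ℂ} (hq0 : q ≠ 0) (hq : ‖q‖ < 1) (n a b : ℤ) :
    (1 - q ^ (n - a)) * ∑' m, vt q n a b m = q ^ b * ∑' m, vt q n (a + 1) b m := by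
  set G : ℤ → ℂ := fun m => - (q ^ (m ^ 2 - (a + b) * m + b - m) *
    (iq q (n - m) * iq q (m - a - 1) * iq q (m - b - 1))) with hG
  have hGs : Summable G := by
    apply summable_icc a n
    intro m hm
    rw [hG]
    simp only
    rw [iq_mul_zero (by omega)]; simp
  have key : ∀ m, (1 - q ^ (n - a)) * vt q n a b m - q ^ b * vt q n (a + 1) b m
      = G m - G (m + 1) := by
    intro m
    have r := iq_rec (norm_pow_ne_one hq)
    simp only [hG, vt]
    have e1 : n - (m + 1) = n - m - 1 := by ring
    have e2 : m + 1 - a - 1 = m - a := by ring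
    have e3 : m + 1 - b - 1 = m - b := by ring
    have e4 : m - (a + 1) = m - a - 1 := by ring
    rw [e1, e2, e3, e4, r (n - m), r (m - a), r (m - b)]
    have e5 : (m + 1) ^ 2 - (a + b) * (m + 1) + b - (m + 1) = (m ^ 2 - (a + b) * m) + m - a := by
      ring
    have e6 : m ^ 2 - (a + 1 + b) * m = (m ^ 2 - (a + b) * m) - m := by ring
    rw [e5, e6]
    generalize m ^ 2 - (a + b) * m = T
    simp only [zpow_add₀ hq0, zpow_sub₀ hq0]
    have h1 := zpow_ne_zero a hq0
    have h2 := zpow_ne_zero b hq0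
    have h3 := zpow_ne_zero m hq0
    have h4 := zpow_ne_zero n hq0
    generalize q ^ a = A at *
    generalize q ^ b = B at *
    generalize q ^ m = M at *
    generalize q ^ n = N at *
    generalize q ^ T = T at *
    field_simp
    ring
  have h := tsum_telescope hGs
  rw [← tsum_congr key, Summable.tsum_sub ((vt_summable _ _ _ _).mul_left _)
    ((vt_summable _ _ _ _).mul_left _), tsum_mul_left, tsum_mul_left] at h
  linear_combination h

lemma one_sub_zpow_ne {q : ℂ} (hq : ‖q‖ < 1) {n : ℤ} (hn : 0 < n) : 1 - q ^ n ≠ 0 := by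
  obtain ⟨m, rfl⟩ : ∃ m : ℕ, n = ((m + 1 : ℕ) : ℤ) := ⟨(n - 1).toNat, by omega⟩
  rw [zpow_natCast]
  intro h
  exact norm_pow_ne_one hq m (sub_eq_zero.mp h).symm

lemma vandermonde {q : ℂ} (hq0 : q ≠ 0) (hq : ‖q‖ < 1) (n a b : ℤ) :
    ∑' m, vt q n a b m = q ^ (-(a * b)) * (iq q (n - a) * iq q (n - b)) := by
  rcases lt_or_ge n a with h | h
  · rw [iq_mul_zero (by omega), mul_zero]
    have : ∀ m, vt q n a b m = 0 := by
      intro m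
      unfold vt
      rw [iq_mul_zero (by omega)]; simp
    simp [this]
  · obtain ⟨k, hk⟩ : ∃ k : ℕ, a = n - k := ⟨(n - a).toNat, by omega⟩
    clear h
    induction k generalizing a with
    | zero =>
      obtain rfl : a = n := by simpa using hk
      rw [tsum_eq_single a]
      · unfold vt
        rw [sub_self, iq_zero]
        have : a ^ 2 - (a + b) * a = -(a * b) := by ring
        rw [this]; ring
      · intro m hm
        unfold vt
        rw [iq_mul_zero (by omega)]; simp
    | succ k ih =>
      have h1 := vt_step hq0 hq n a b
      rw [ih (a + 1) (by push_cast at hk; linarith)] at h1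
      have h2 : 1 - q ^ (n - a) ≠ 0 := one_sub_zpow_ne hq (by push_cast at hk; linarith)
      apply mul_left_cancel₀ h2
      rw [h1]
      have e : n - (a + 1) = n - a - 1 := by ring
      rw [e, iq_rec (norm_pow_ne_one hq) (n - a)]
      have e2 : -((a + 1) * b) = -(a * b) - b := by ring
      rw [e2, zpow_sub₀ hq0]
      have := zpow_ne_zero b hq0
      field_simp

lemma et_summable {q : ℂ} (hq0 : q ≠ 0) (hq : ‖q‖ < 1) (c a b : ℤ) :
    Summable fun m : ℤ => q ^ (m ^ 2 - c * m) * (iq q (m - a) * iq q (m - b)) := by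
  obtain ⟨C, hC0, hC⟩ := iq_bdd hq
  have h := sumZ_of (norm_pos_iff.mpr hq0) hq _ _ (quad_bound c)
  refine Summable.of_norm_bounded (h.mul_right (C * C)) ?_
  intro m
  rw [norm_mul, norm_mul, norm_zpow]
  gcongr <;> apply hC

lemma vandermonde_inf {q : ℂ} (hq0 : q ≠ 0) (hq : ‖q‖ < 1) (a b : ℤ) :
    ∑' m : ℤ, q ^ (m ^ 2 - (a + b) * m) * (iq q (m - a) * iq q (m - b))
      = q ^ (-(a * b)) * (qInf q)⁻¹ := by
  obtain ⟨C, hC0, hC⟩ := iq_bdd hq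
  have hs := sumZ_of (norm_pos_iff.mpr hq0) hq _ _ (quad_bound (a + b))
  have h1 : Tendsto (fun n : ℕ => ∑' m, vt q n a b m) atTop (𝓝 (∑' m : ℤ,
      q ^ (m ^ 2 - (a + b) * m) * ((qInf q)⁻¹ * iq q (m - a) * iq q (m - b)))) := by
    refine tendsto_tsum_of_dominated_convergence (hs.mul_right (C * C * C)) ?_ ?_
    · intro m
      unfold vt
      refine Tendsto.const_mul _ (Tendsto.mul_const _ (Tendsto.mul_const _ ?_))
      exact iq_tendsto hq (-m)
    · refine Eventually.of_forall fun n m => ?_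
      unfold vt
      rw [norm_mul, norm_mul, norm_mul, norm_zpow]
      gcongr <;> apply hC
  have h2 : Tendsto (fun n : ℕ => ∑' m, vt q n a b m) atTop
      (𝓝 (q ^ (-(a * b)) * ((qInf q)⁻¹ * (qInf q)⁻¹))) := by
    simp_rw [vandermonde hq0 hq]
    exact Tendsto.const_mul _ ((iq_tendsto hq (-a)).mul (iq_tendsto hq (-b)))
  have h3 := tendsto_nhds_unique h1 h2
  have h4 : ∀ m : ℤ, q ^ (m ^ 2 - (a + b) * m) * ((qInf q)⁻¹ * iq q (m - a) * iq q (m - b))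
      = (qInf q)⁻¹ * (q ^ (m ^ 2 - (a + b) * m) * (iq q (m - a) * iq q (m - b))) := by
    intro m; ring
  rw [tsum_congr h4, tsum_mul_left] at h3
  have h5 := inv_ne_zero (qInf_ne_zero hq)
  apply mul_left_cancel₀ h5
  rw [h3]; ring

/-- unit Bailey pair -/
lemma unit_pair {q : ℂ} (hq0 : q ≠ 0) (hq : ‖q‖ < 1) (n : ℤ) :
    ∑' r : ℤ, (-1) ^ r * q ^ (tri r) * (iq q (n - r) * iq q (n + r)) = if n = 0 then 1 else 0 := by
  have hm1 : (-1 : ℂ) ≠ 0 := by norm_num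
  set t : ℤ → ℂ := fun r => (-1) ^ r * q ^ (tri r) * (iq q (n - r) * iq q (n + r)) with ht
  have hts : Summable t := by
    apply summable_icc (-n) n
    intro m hm
    simp only [ht]
    rw [iq_mul_zero (by omega)]; simp
  split_ifs with h
  · subst h
    rw [tsum_eq_single 0]
    · simp [iq_zero, tri]
    · intro r hr
      rw [iq_mul_zero (by omega)]; simp
  rcases lt_or_ge n 0 with h0 | h0
  · have : ∀ r, t r = 0 := by
      intro r
      simp only [ht]
      rw [iq_mul_zero (by omega)]; simp
    exact (tsum_congr this).trans tsum_zero
  have hn : 0 < n := by omega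
  set G : ℤ → ℂ := fun r => (-1) ^ r * q ^ (tri r) * (iq q (n - r) * iq q (n + r - 1)) with hG
  have hGs : Summable G := by
    apply summable_icc (-n) n
    intro m hm
    simp only [hG]
    rw [iq_mul_zero (by omega)]; simp
  have h1 : ∀ r, G r - G (r + 1) = (1 - q ^ n) * (t r + t (-r)) := by
    intro r
    have rr := iq_rec (norm_pow_ne_one hq)
    simp only [hG, ht]
    have e1 : n - (r + 1) = n - r - 1 := by ring
    have e2 : n + (r + 1) - 1 = n + r := by ring
    have e3 : n - -r = n + r := by ring
    have e4 : n + -r = n - r := by ring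
    have e5 : (-1 : ℂ) ^ (-r) = (-1) ^ r := by
      rw [zpow_neg]
      rcases Int.even_or_odd r with h | h
      · simp [h.neg_one_zpow]
      · simp [h.neg_one_zpow]
    rw [e1, e2, e3, e4, e5, rr (n - r), rr (n + r), tri_succ, tri_neg, zpow_add₀ hm1]
    simp only [zpow_add₀ hq0, zpow_sub₀ hq0]
    have h3 := zpow_ne_zero r hq0
    have h4 := zpow_ne_zero n hq0
    generalize q ^ n = N at *
    generalize q ^ r = R at *
    field_simp
    ring
  have h2 := tsum_telescope hGs
  have hts' : Summable fun r => t (-r) := (Equiv.neg ℤ).summable_iff.mpr hts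
  have h3 : ∑' r, t (-r) = ∑' r, t r := (Equiv.neg ℤ).tsum_eq t
  rw [tsum_congr h1, tsum_mul_left, hts.tsum_add hts', h3] at h2
  have h4 := one_sub_zpow_ne hq hn
  have h5 := (mul_eq_zero.mp h2).resolve_left h4
  linear_combination h5 / 2

lemma qB_summable (q : ℂ) (t : ℕ) (f : ℤ → ℂ) : Summable fun j : ℤ => qB q (t : ℤ) j * f j := by
  apply summable_icc 0 t
  intro m hm
  rw [qB_eq, mul_assoc (qP q t), iq_mul_zero (by omega)]; simp

lemma qB_pascal {q : ℂ} (hq0 : q ≠ 0) (hq : ‖q‖ < 1) (t : ℕ) (j : ℤ) :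
    qB q⁻¹ ((t + 1 : ℕ) : ℤ) j = qB q⁻¹ (t : ℤ) j + q ^ (j - (t + 1)) * qB q⁻¹ (t : ℤ) (j - 1) := by
  have rr := iq_rec (inv_pow_ne_one hq)
  rw [qB_eq, qB_eq, qB_eq]
  have e1 : qP q⁻¹ (t + 1) = qP q⁻¹ t * (1 - q⁻¹ ^ ((t : ℤ) + 1)) := by
    simp only [qP, Finset.prod_range_succ]
    norm_cast
  have e2 : ((t + 1 : ℕ) : ℤ) - j = (t : ℤ) + 1 - j := by push_cast; ring
  have e3 : (t : ℤ) - j = (t : ℤ) + 1 - j - 1 := by ring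
  have e4 : (t : ℤ) - (j - 1) = (t : ℤ) + 1 - j := by ring
  rw [e1, e2, e3, e4, rr j, rr ((t : ℤ) + 1 - j)]
  simp only [inv_zpow', zpow_neg, neg_sub, zpow_add₀ hq0, zpow_sub₀ hq0, neg_add]
  have h1 := zpow_ne_zero j hq0
  have h2 := zpow_ne_zero (t : ℤ) hq0
  generalize q ^ j = J at *
  generalize q ^ (t : ℤ) = T at *
  field_simp
  ring

lemma E_formula {q : ℂ} (hq0 : q ≠ 0) (hq : ‖q‖ < 1) (t : ℕ) (a b : ℤ) :
    ∑' m : ℤ, q ^ (m ^ 2 - (a + b + t) * m) * (iq q (m - a) * iq q (m - b))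
      = (qInf q)⁻¹ * ∑' j : ℤ, qB q⁻¹ (t : ℤ) j * q ^ (-((a + j) * b) - a * (t - j)) := by
  induction t generalizing a with
  | zero =>
    have h0 : ∑' j : ℤ, qB q⁻¹ ((0 : ℕ) : ℤ) j * q ^ (-((a + j) * b) - a * ((0 : ℕ) - j))
        = q ^ (-(a * b)) := by
      rw [tsum_eq_single (0 : ℤ)]
      · simp [qB, qP]
      · intro j hj
        rw [qB_eq, mul_assoc (qP q⁻¹ 0), iq_mul_zero (by push_cast; omega)]; simp
    rw [h0, mul_comm, ← vandermonde_inf hq0 hq a b]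
    simp
  | succ t ih =>
    have h1 : ∀ m : ℤ, q ^ (m ^ 2 - (a + b + (t + 1 : ℕ)) * m) * (iq q (m - a) * iq q (m - b))
        = q ^ (m ^ 2 - (a + 1 + b + t) * m) * (iq q (m - (a + 1)) * iq q (m - b))
          + q ^ (-a) * (q ^ (m ^ 2 - (a + b + t) * m) * (iq q (m - a) * iq q (m - b))) := by
      intro m
      have e1 : m ^ 2 - (a + b + (t + 1 : ℕ)) * m = m ^ 2 - (a + b + t) * m - m := by
        push_cast; ring
      have e2 : m ^ 2 - (a + 1 + b + t) * m = m ^ 2 - (a + b + t) * m - m := by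
        ring
      have e3 : m - (a + 1) = m - a - 1 := by ring
      rw [e1, e2, e3, iq_rec (norm_pow_ne_one hq)]
      generalize m ^ 2 - (a + b + t) * m = T
      simp only [zpow_sub₀ hq0, zpow_neg]
      have h3 := zpow_ne_zero m hq0
      have h4 := zpow_ne_zero a hq0
      field_simp
      ring
    rw [tsum_congr h1, Summable.tsum_add (et_summable hq0 hq _ _ _)
      ((et_summable hq0 hq _ _ _).mul_left _), tsum_mul_left, ih (a + 1), ih a]
    have h2 : ∀ j : ℤ, qB q⁻¹ ((t + 1 : ℕ) : ℤ) j * q ^ (-((a + j) * b) - a * ((t + 1 : ℕ) - j))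
        = qB q⁻¹ (t : ℤ) (j - 1) * q ^ (-((a + 1 + (j - 1)) * b) - (a + 1) * (t - (j - 1)))
          + q ^ (-a) * (qB q⁻¹ (t : ℤ) j * q ^ (-((a + j) * b) - a * (t - j))) := by
      intro j
      rw [qB_pascal hq0 hq]
      have e1 : -((a + j) * b) - a * ((t + 1 : ℕ) - j) = -((a + j) * b) - a * (t - j) - a := by
        push_cast; ring
      have e2 : -((a + 1 + (j - 1)) * b) - (a + 1) * (t - (j - 1))
        = -((a + j) * b) - a * (t - j) - a + (j - (t + 1)) := by
        ring
      rw [e1, e2]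
      generalize -((a + j) * b) - a * (t - j) = T
      rw [zpow_add₀ hq0 _ (j - (t + 1)), zpow_sub₀ hq0 T a, zpow_neg]
      have h4 := zpow_ne_zero a hq0
      field_simp
      ring
    obtain ⟨F, hF⟩ : ∃ F : ℤ → ℂ, F = fun j => qB q⁻¹ (t : ℤ) j *
        q ^ (-((a + 1 + j) * b) - (a + 1) * (t - j)) := ⟨_, rfl⟩
    have h3 : Summable F := hF ▸ qB_summable q⁻¹ t _
    have h3' : Summable fun j : ℤ => F (j - 1) := (Equiv.subRight (1 : ℤ)).summable_iff.mpr h3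
    have h5 : ∑' j : ℤ, F (j - 1) = ∑' j, F j := (Equiv.subRight (1 : ℤ)).tsum_eq F
    have h2' : ∀ j : ℤ,
        qB q⁻¹ ((t + 1 : ℕ) : ℤ) j * q ^ (-((a + j) * b) - a * ((t + 1 : ℕ) - j))
        = F (j - 1) + q ^ (-a) * (qB q⁻¹ (t : ℤ) j * q ^ (-((a + j) * b) - a * (t - j))) := by
      intro j
      rw [h2, hF]
    rw [tsum_congr h2', Summable.tsum_add h3' ((qB_summable _ _ _).mul_left _), tsum_mul_left,
      h5, hF]
    ring

/-- Bailey pair beta -/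
def bet (q : ℂ) (ν : ℕ) (m : ℤ) : ℂ :=
  ∑' r : ℤ, (-1) ^ r * q ^ ((2 * ν + 1) * tri r + ν * r) * (iq q (m - r) * iq q (m + r))

lemma bet_neg (q : ℂ) (ν : ℕ) {m : ℤ} (hm : m < 0) : bet q ν m = 0 := by
  unfold bet
  refine (tsum_congr fun r => ?_).trans tsum_zero
  rw [iq_mul_zero (by omega)]; simp

lemma bet_zero {q : ℂ} (hq0 : q ≠ 0) (hq : ‖q‖ < 1) (m : ℤ) :
    bet q 0 m = if m = 0 then 1 else 0 := by
  rw [← unit_pair hq0 hq m]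
  unfold bet
  simp

lemma bet_summand_bdd {q : ℂ} (hq0 : q ≠ 0) (hq : ‖q‖ < 1) (ν : ℕ) :
    ∃ u : ℤ → ℝ, Summable u ∧ (∀ r, 0 ≤ u r) ∧ ∀ m r : ℤ,
      ‖(-1) ^ r * q ^ ((2 * ν + 1) * tri r + ν * r) * (iq q (m - r) * iq q (m + r))‖ ≤ u r := by
  obtain ⟨C, hC0, hC⟩ := iq_bdd hq
  have hs := sumZ_of (norm_pos_iff.mpr hq0) hq _ _ (tri_bound (2 * ν + 1) (by omega) ν)
  refine ⟨_, hs.mul_right (C * C), fun r => by positivity, fun m r => ?_⟩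
  rw [norm_mul, norm_mul, norm_mul, norm_zpow, norm_zpow, norm_neg, norm_one, one_zpow, one_mul]
  gcongr <;> apply hC

lemma bet_bdd {q : ℂ} (hq0 : q ≠ 0) (hq : ‖q‖ < 1) (ν : ℕ) :
    ∃ C : ℝ, 0 ≤ C ∧ ∀ m, ‖bet q ν m‖ ≤ C := by
  obtain ⟨u, hu, hu0, h⟩ := bet_summand_bdd hq0 hq ν
  refine ⟨∑' r, u r, tsum_nonneg hu0, fun m => ?_⟩
  exact tsum_of_norm_bounded hu.hasSum (h m)

lemma bailey_step {q : ℂ} (hq0 : q ≠ 0) (hq : ‖q‖ < 1) (ν : ℕ) (N : ℤ) :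
    ∑' m : ℤ, iq q (N - m) * (q ^ (m ^ 2) * bet q ν m) = bet q (ν + 1) N := by
  set f : ℤ → ℤ → ℂ := fun m r => iq q (N - m) * (q ^ (m ^ 2) * ((-1) ^ r *
    q ^ ((2 * ν + 1) * tri r + ν * r) * (iq q (m - r) * iq q (m + r)))) with hf
  have hs : Summable (Function.uncurry f) := by
    apply summable_of_ne_finset_zero (s := Finset.Icc 0 N ×ˢ Finset.Icc (-N) N)
    rintro ⟨m, r⟩ hm
    rw [Finset.mem_product, Finset.mem_Icc, Finset.mem_Icc] at hm
    simp only [Function.uncurry, hf]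
    simp only at hm
    rcases lt_or_ge N m with h | h
    · rw [iq_neg q (by omega)]; simp
    · rw [iq_mul_zero (by omega)]; simp
  have h1 : ∑' m : ℤ, iq q (N - m) * (q ^ (m ^ 2) * bet q ν m) = ∑' m, ∑' r, f m r := by
    refine tsum_congr fun m => ?_
    simp only [hf, bet, tsum_mul_left]
  rw [h1, ← hs.tsum_comm]
  unfold bet
  refine tsum_congr fun r => ?_
  have h2 : ∀ m, f m r = (-1) ^ r * q ^ ((2 * ν + 1) * tri r + ν * r) * vt q N r (-r) m := by
    intro m
    simp only [hf, vt]
    rw [add_neg_cancel, zero_mul, sub_zero, sub_neg_eq_add]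
    ring
  rw [tsum_congr h2, tsum_mul_left, vandermonde hq0 hq]
  have e : (2 * ((ν + 1 : ℕ) : ℤ) + 1) * tri r + ((ν + 1 : ℕ) : ℤ) * r
     = ((2 * ν + 1) * tri r + ν * r) + -(r * -r) := by
    push_cast
    linear_combination two_tri r
  rw [e, zpow_add₀ hq0 _ (-(r * -r)), sub_neg_eq_add]
  ring

lemma NN_one {ν : ℕ} (n : Fin ν → ℕ) : NN n 1 = ∑ k, n k := by
  simp [NN]

lemma NN_cons_succ {ν : ℕ} (a : ℕ) (n : Fin ν → ℕ) (i : ℕ) (hi : 1 ≤ i) :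
    NN (Fin.cons a n : Fin (ν + 1) → ℕ) (i + 1) = NN n i := by
  unfold NN
  rw [Fin.sum_univ_succ]
  simp only [Fin.cons_zero, Fin.cons_succ, Fin.val_zero, Fin.val_succ, add_le_add_iff_right]
  rw [if_neg (by omega), zero_add]

lemma NN_cons_one {ν : ℕ} (a : ℕ) (n : Fin ν → ℕ) :
    NN (Fin.cons a n : Fin (ν + 1) → ℕ) 1 = a + NN n 1 := by
  rw [NN_one, NN_one, Fin.sum_univ_succ]; simp

/-- exponent sum starting from index 2 -/
def e2 {ν : ℕ} (n : Fin ν → ℕ) : ℕ := ∑ i ∈ Finset.Icc 2 ν, (NN n i) ^ 2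

lemma e2_one {ν : ℕ} (n : Fin ν → ℕ) :
    ∑ i ∈ Finset.Icc 1 ν, (NN n i) ^ 2 = NN n 1 ^ 2 + e2 n := by
  unfold e2
  rcases Nat.eq_zero_or_pos ν with h | h
  · subst h; simp [NN_one]
  · rw [← Finset.add_sum_Ioc_eq_sum_Icc (by omega)]
    rfl

lemma e2_cons {ν : ℕ} (a : ℕ) (n : Fin ν → ℕ) :
    e2 (Fin.cons a n : Fin (ν + 1) → ℕ) = NN n 1 ^ 2 + e2 n := by
  rw [← e2_one]
  unfold e2
  have h : Finset.Icc 2 (ν + 1) = (Finset.Icc 1 ν).map (addRightEmbedding 1) := by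
    rw [Finset.map_add_right_Icc]
  rw [h, Finset.sum_map]
  refine Finset.sum_congr rfl fun i hi => ?_
  rw [addRightEmbedding_apply, NN_cons_succ a n i (Finset.mem_Icc.mp hi).1]

/-- weight without the first square -/
def bw (q : ℂ) {ν : ℕ} (n : Fin ν → ℕ) : ℂ := q ^ (e2 n) * ∏ i, iq q (n i)

lemma bw_cons (q : ℂ) {ν : ℕ} (a : ℕ) (n : Fin ν → ℕ) :
    bw q (Fin.cons a n : Fin (ν + 1) → ℕ) = iq q a * (q ^ (NN n 1 ^ 2) * bw q n) := by
  unfold bw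
  rw [e2_cons, Fin.prod_univ_succ, pow_add]
  simp only [Fin.cons_zero, Fin.cons_succ]
  ring

lemma bw_bdd {q : ℂ} (hq : ‖q‖ < 1) (ν : ℕ) : ∃ C : ℝ, 0 ≤ C ∧ ∀ n : Fin ν → ℕ, ‖bw q n‖ ≤ C := by
  obtain ⟨C, hC0, hC⟩ := iq_bdd hq
  refine ⟨C ^ ν, by positivity, fun n => ?_⟩
  unfold bw
  rw [norm_mul, norm_pow, norm_prod]
  have h1 : ‖q‖ ^ e2 n ≤ 1 := pow_le_one₀ (norm_nonneg _) hq.le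
  have h2 : ∏ i, ‖iq q (n i)‖ ≤ C ^ ν := by
    calc ∏ i, ‖iq q (n i)‖ ≤ ∏ _i : Fin ν, C :=
          Finset.prod_le_prod (fun _ _ => norm_nonneg _) (fun i _ => hC _)
      _ = C ^ ν := by simp
  calc _ ≤ 1 * C ^ ν := by gcongr
    _ = _ := one_mul _

lemma summable_fin {r : ℝ} (h0 : 0 ≤ r) (h1 : r < 1) (ν : ℕ) :
    Summable fun n : Fin ν → ℕ => r ^ (NN n 1) := by
  induction ν with
  | zero => exact Summable.of_finite
  | succ ν ih =>
    rw [← (Fin.consEquiv fun _ => ℕ).summable_iff]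
    have := (summable_geometric_of_lt_one h0 h1).mul_of_nonneg ih (fun _ => by positivity)
      (fun _ => by positivity)
    refine this.congr ?_
    rintro ⟨a, n⟩
    change r ^ a * r ^ NN n 1 = r ^ NN (Fin.cons a n : Fin (ν + 1) → ℕ) 1
    rw [NN_cons_one, pow_add]

lemma fin_summable {q : ℂ} (hq : ‖q‖ < 1) (ν : ℕ) (g : ℕ → ℂ) (C : ℝ)
    (hg : ∀ N, ‖g N‖ ≤ C * ‖q‖ ^ N) :
    Summable fun n : Fin ν → ℕ => g (NN n 1) * bw q n := by
  obtain ⟨D, hD0, hD⟩ := bw_bdd hq ν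
  refine Summable.of_norm_bounded (((summable_fin (norm_nonneg q) hq ν).mul_left C).mul_right D) ?_
  intro n
  rw [norm_mul]
  exact mul_le_mul (hg _) (hD _) (norm_nonneg _) ((norm_nonneg _).trans (hg _))

lemma tsum_int_nat {f : ℤ → ℂ} (h : ∀ m : ℤ, m < 0 → f m = 0) :
    ∑' m : ℤ, f m = ∑' m : ℕ, f m := by
  symm
  apply Function.Injective.tsum_eq (g := fun m : ℕ => (m : ℤ)) (fun a b h => by simpa using h)
  intro m hm
  by_contra h2
  apply hm
  apply h
  by_contra h3
  exact h2 ⟨m.toNat, by simp; omega⟩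

lemma shift_tsum (q : ℂ) (g : ℕ → ℂ) (m : ℕ) :
    ∑' n : ℕ, g (n + m) * iq q (n : ℤ) = ∑' N : ℕ, g N * iq q ((N : ℤ) - m) := by
  have := Function.Injective.tsum_eq (g := fun n : ℕ => n + m) (add_left_injective m)
    (f := fun N : ℕ => g N * iq q ((N : ℤ) - m)) (by
      intro N hN
      by_contra h2
      apply hN
      have : N < m := by
        by_contra h3
        exact h2 ⟨N - m, by simp; omega⟩
      simp only
      rw [iq_neg q (by omega), mul_zero])
  rw [← this]
  refine tsum_congr fun n => ?_
  congr 2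
  push_cast; ring

lemma chain {q : ℂ} (hq0 : q ≠ 0) (hq : ‖q‖ < 1) (ν : ℕ) (g : ℕ → ℂ) (C : ℝ)
    (hg : ∀ N, ‖g N‖ ≤ C * ‖q‖ ^ N) :
    ∑' n : Fin ν → ℕ, g (NN n 1) * bw q n = ∑' m : ℕ, g m * bet q ν m := by
  induction ν generalizing g C with
  | zero =>
    rw [tsum_eq_single (0 : ℕ)]
    · rw [tsum_eq_single (fun _ => 0)]
      · simp [NN_one, bw, e2, bet_zero hq0 hq]
      · intro n hn
        exact absurd (Subsingleton.elim _ _) hn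
    · intro m hm
      rw [bet_zero hq0 hq, if_neg (by simpa using hm), mul_zero]
  | succ ν ih =>
    have hC : 0 ≤ C := by simpa using (norm_nonneg _).trans (hg 0)
    obtain ⟨D, hD0, hD⟩ := iq_bdd hq
    obtain ⟨E, hE0, hE⟩ := bet_bdd hq0 hq ν
    have hgeo := summable_geometric_of_lt_one (norm_nonneg q) hq
    set e : (Fin ν → ℕ) × ℕ ≃ (Fin (ν + 1) → ℕ) :=
      (Equiv.prodComm _ _).trans (Fin.consEquiv fun _ => ℕ) with he
    have hsum := fin_summable hq (ν + 1) g C hg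
    rw [← e.tsum_eq]
    have hsum' := e.summable_iff.mpr hsum
    rw [show (∑' c, g (NN (e c) 1) * bw q (e c)) =
      ∑' c, ((fun n : Fin (ν + 1) → ℕ => g (NN n 1) * bw q n) ∘ e) c from rfl,
      hsum'.tsum_prod]
    have hin : ∀ t : Fin ν → ℕ, ∑' n : ℕ,
        ((fun n : Fin (ν + 1) → ℕ => g (NN n 1) * bw q n) ∘ e) (t, n)
        = (fun T : ℕ => q ^ (T ^ 2) * ∑' n : ℕ, g (n + T) * iq q (n : ℤ)) (NN t 1) * bw q t := by
      intro t
      simp only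
      rw [mul_comm, ← mul_assoc, ← tsum_mul_left]
      refine tsum_congr fun n => ?_
      change g (NN (Fin.cons n t : Fin (ν + 1) → ℕ) 1) * bw q (Fin.cons n t : Fin (ν + 1) → ℕ) = _
      rw [NN_cons_one, bw_cons]
      ring
    rw [tsum_congr hin]
    have hbound : ∀ T : ℕ, ‖∑' n : ℕ, g (n + T) * iq q (n : ℤ)‖
        ≤ (C * D * ∑' n : ℕ, ‖q‖ ^ n) * ‖q‖ ^ T := by
      intro T
      have h1 : HasSum (fun n : ℕ => C * D * ‖q‖ ^ T * ‖q‖ ^ n)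
        (C * D * ‖q‖ ^ T * ∑' n : ℕ, ‖q‖ ^ n) := hgeo.hasSum.mul_left _
      refine (tsum_of_norm_bounded h1 fun n => ?_).trans (le_of_eq (by ring))
      rw [norm_mul]
      calc _ ≤ (C * ‖q‖ ^ (n + T)) * D := by
              gcongr
              · exact hg _
              · exact hD _
        _ = _ := by rw [pow_add]; ring
    rw [ih (fun T : ℕ => q ^ (T ^ 2) * ∑' n : ℕ, g (n + T) * iq q (n : ℤ)) (C * D * ∑' n : ℕ, ‖q‖ ^ n) ?_]
    swap
    · intro T
      rw [norm_mul, norm_pow]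
      have h1 : ‖q‖ ^ (T ^ 2) ≤ 1 := pow_le_one₀ (norm_nonneg _) hq.le
      calc _ ≤ 1 * ((C * D * ∑' n : ℕ, ‖q‖ ^ n) * ‖q‖ ^ T) := by
            gcongr
            exact hbound T
        _ = _ := one_mul _
    set f : ℕ → ℕ → ℂ := fun m N => g N * iq q ((N : ℤ) - m) * (q ^ (m ^ 2) * bet q ν m) with hf
    have h1 : ∀ m : ℕ, (q ^ (m ^ 2) * ∑' n : ℕ, g (n + m) * iq q (n : ℤ)) * bet q ν m
        = ∑' N, f m N := by
      intro m
      rw [shift_tsum, hf]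
      simp only
      rw [tsum_mul_right]
      ring
    rw [tsum_congr h1]
    have hs : Summable (Function.uncurry f) := by
      have := (hgeo.mul_of_nonneg hgeo (fun _ => by positivity)
        (fun _ => by positivity)).mul_left (C * D * E)
      refine Summable.of_norm_bounded this ?_
      rintro ⟨m, N⟩
      simp only [Function.uncurry, hf]
      rw [norm_mul, norm_mul, norm_mul, norm_pow]
      have h1 : ‖q‖ ^ (m ^ 2) ≤ ‖q‖ ^ m := by
        apply pow_le_pow_of_le_one (norm_nonneg _) hq.le
        nlinarith [Nat.zero_le m, sq_nonneg (m : ℤ), Nat.le_self_pow (two_ne_zero) m]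
      calc _ ≤ (C * ‖q‖ ^ N) * D * (‖q‖ ^ m * E) := by
              gcongr
              · exact hg _
              · exact hD _
              · exact hE _
        _ = _ := by ring
    rw [← hs.tsum_comm]
    refine tsum_congr fun N => ?_
    rw [← bailey_step hq0 hq, tsum_int_nat, ← tsum_mul_left]
    · refine tsum_congr fun m => ?_
      simp only [hf]
      have : q ^ ((m : ℤ) ^ 2) = q ^ (m ^ 2) := by norm_cast
      rw [this]
      ring
    · intro m hm
      rw [bet_neg q ν hm]; simp

lemma shift_sub_summable {F : ℤ → ℂ} (h : Summable F) : Summable fun r => F (r - 1) :=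
  (Equiv.subRight (1 : ℤ)).summable_iff.mpr h

lemma shift_add_summable {F : ℤ → ℂ} (h : Summable F) : Summable fun r => F (r + 1) :=
  (Equiv.addRight (1 : ℤ)).summable_iff.mpr h

lemma shift_sub_tsum (F : ℤ → ℂ) : ∑' r, F (r - 1) = ∑' r, F r :=
  (Equiv.subRight (1 : ℤ)).tsum_eq F

lemma shift_add_tsum (F : ℤ → ℂ) : ∑' r, F (r + 1) = ∑' r, F r :=
  (Equiv.addRight (1 : ℤ)).tsum_eq F

/-- finite Jacobi triple product sum -/
def jt (p z : ℂ) (n r : ℤ) : ℂ :=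
  (-1) ^ r * z ^ r * p ^ (tri r) * (iq p (n - r) * iq p (n + r))

lemma jt_summable (p z : ℂ) (n : ℤ) : Summable (jt p z n) := by
  apply summable_icc (-n) n
  intro m hm
  unfold jt
  rw [iq_mul_zero (by omega)]; simp

set_option maxHeartbeats 1000000 in
lemma jt_key {p z : ℂ} (hp0 : p ≠ 0) (hp : ‖p‖ < 1) (hz : z ≠ 0) (n r : ℤ) :
    (1 - p ^ (2 * n + 1)) * (1 - p ^ (2 * n + 2)) * jt p z (n + 1) r
      = (1 + p ^ (2 * n + 1)) * jt p z n r - z * p ^ n * jt p z n (r - 1)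
        - p ^ (n + 1) * z⁻¹ * jt p z n (r + 1) := by
  have hm1 : (-1 : ℂ) ≠ 0 := by norm_num
  have rr := iq_rec (norm_pow_ne_one hp)
  have a1 : iq p (n - r) = (1 - p ^ (n + 1 - r)) * iq p (n + 1 - r) := by
    rw [← rr]; congr 1; ring
  have a2 : iq p (n + r) = (1 - p ^ (n + 1 + r)) * iq p (n + 1 + r) := by
    rw [← rr]; congr 1; ring
  have a3 : iq p (n - (r - 1)) = iq p (n + 1 - r) := by congr 1; ring
  have a4 : iq p (n + (r - 1)) = (1 - p ^ (n + r)) * iq p (n + r) := by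
    rw [← rr]; congr 1; ring
  have a5 : iq p (n - (r + 1)) = (1 - p ^ (n - r)) * iq p (n - r) := by
    rw [← rr]; congr 1; ring
  have a6 : iq p (n + (r + 1)) = iq p (n + 1 + r) := by congr 1; ring
  unfold jt
  rw [a3, a4, a5, a6, a1, a2, tri_succ, tri_pred]
  have b1 : p ^ (2 * n + 1) = p ^ n * p ^ n * p := by
    rw [two_mul, zpow_add₀ hp0, zpow_add₀ hp0, zpow_one]
  have b2 : p ^ (2 * n + 2) = p ^ n * p ^ n * p * p := by
    rw [show 2 * n + 2 = 2 * n + 1 + 1 by ring, zpow_add₀ hp0, b1, zpow_one]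
  rw [b1, b2]
  simp only [zpow_add₀ hp0, zpow_sub₀ hp0, zpow_add₀ hz, zpow_sub₀ hz, zpow_one,
    zpow_add₀ hm1, zpow_sub₀ hm1]
  have h1 := zpow_ne_zero n hp0
  have h2 := zpow_ne_zero r hp0
  have h3 := zpow_ne_zero r hz
  generalize p ^ n = P at *
  generalize p ^ r = R at *
  generalize z ^ r = Z at *
  generalize p ^ tri r = T at *
  generalize (-1 : ℂ) ^ r = S at *
  generalize iq p (n + 1 - r) = X at *
  generalize iq p (n + 1 + r) = Y at *
  clear rr a1 a2 a3 a4 a5 a6 b1 b2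
  field_simp
  ring

lemma jt_step {p z : ℂ} (hp0 : p ≠ 0) (hp : ‖p‖ < 1) (hz : z ≠ 0) (n : ℤ) :
    (1 - p ^ (2 * n + 1)) * (1 - p ^ (2 * n + 2)) * ∑' r, jt p z (n + 1) r
      = (1 - z * p ^ n) * (1 - p ^ (n + 1) * z⁻¹) * ∑' r, jt p z n r := by
  have hm1 : (-1 : ℂ) ≠ 0 := by norm_num
  have s0 := jt_summable p z n
  have s1 := shift_sub_summable s0
  have s2 := shift_add_summable s0
  have t1 := shift_sub_tsum (jt p z n)
  have t2 := shift_add_tsum (jt p z n)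
  have key := jt_key hp0 hp hz n
  have h : (1 - p ^ (2 * n + 1)) * (1 - p ^ (2 * n + 2)) * ∑' r, jt p z (n + 1) r
      = (1 + p ^ (2 * n + 1)) * ∑' r, jt p z n r - z * p ^ n * ∑' r, jt p z n r
        - p ^ (n + 1) * z⁻¹ * ∑' r, jt p z n r := by
    rw [← tsum_mul_left, tsum_congr key, Summable.tsum_sub ((s0.mul_left _).sub (s1.mul_left _))
      (s2.mul_left _), Summable.tsum_sub (s0.mul_left _) (s1.mul_left _), tsum_mul_left,
      tsum_mul_left, tsum_mul_left, t1, t2]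
  rw [h]
  have b1 : p ^ (2 * n + 1) = p ^ n * p ^ n * p := by
    rw [two_mul, zpow_add₀ hp0, zpow_add₀ hp0, zpow_one]
  rw [b1, zpow_add₀ hp0, zpow_one]
  generalize ∑' r, jt p z n r = X
  generalize p ^ n = P
  field_simp
  ring

lemma jt_finite {p z : ℂ} (hp0 : p ≠ 0) (hp : ‖p‖ < 1) (hz : z ≠ 0) (n : ℕ) :
    qP p (2 * n) * ∑' r, jt p z n r
      = (∏ i ∈ Finset.range n, (1 - z * p ^ i)) * ∏ i ∈ Finset.range n, (1 - p ^ (i + 1) * z⁻¹) := by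
  induction n with
  | zero =>
    rw [tsum_eq_single 0]
    · simp [jt, qP, iq_zero, tri]
    · intro r hr
      unfold jt
      rw [iq_mul_zero (by push_cast; omega)]; simp
  | succ n ih =>
    have h := jt_step hp0 hp hz n
    have h1 : qP p (2 * (n + 1)) = qP p (2 * n) * ((1 - p ^ (2 * n + 1)) * (1 - p ^ (2 * n + 2))) := by
      rw [show 2 * (n + 1) = 2 * n + 1 + 1 by ring]
      simp only [qP, Finset.prod_range_succ]
      ring
    have e1 : p ^ (2 * (n : ℤ) + 1) = p ^ (2 * n + 1) := by norm_cast
    have e2 : p ^ (2 * (n : ℤ) + 2) = p ^ (2 * n + 2) := by norm_cast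
    have e3 : p ^ ((n : ℤ) + 1) = p ^ (n + 1) := by norm_cast
    rw [e1, e2, e3, zpow_natCast] at h
    rw [Finset.prod_range_succ, Finset.prod_range_succ, h1, mul_assoc, Nat.cast_succ, h]
    linear_combination (1 - z * p ^ n) * (1 - p ^ (n + 1) * z⁻¹) * ih

lemma jtp {p z : ℂ} (hp0 : p ≠ 0) (hp : ‖p‖ < 1) (hz : z ≠ 0)
    (hs : Summable fun r : ℤ => ‖z ^ r * p ^ (tri r)‖)
    (h1 : Multipliable fun i : ℕ => 1 - z * p ^ i)
    (h2 : Multipliable fun i : ℕ => 1 - p ^ (i + 1) * z⁻¹) :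
    ∑' r : ℤ, (-1) ^ r * z ^ r * p ^ (tri r)
      = qInf p * ((∏' i : ℕ, (1 - z * p ^ i)) * ∏' i : ℕ, (1 - p ^ (i + 1) * z⁻¹)) := by
  obtain ⟨C, hC0, hC⟩ := iq_bdd hp
  have l1 : Tendsto (fun n : ℕ => ∑' r, jt p z n r) atTop (𝓝 (∑' r : ℤ,
      (-1) ^ r * z ^ r * p ^ (tri r) * ((qInf p)⁻¹ * (qInf p)⁻¹))) := by
    refine tendsto_tsum_of_dominated_convergence (hs.mul_right (C * C)) ?_ ?_
    · intro r
      unfold jt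
      exact Tendsto.const_mul _ ((iq_tendsto hp (-r)).mul (iq_tendsto hp r))
    · refine Eventually.of_forall fun n r => ?_
      unfold jt
      rw [mul_assoc ((-1 : ℂ) ^ r), norm_mul, norm_mul, norm_mul, norm_zpow, norm_neg, norm_one,
        one_zpow, one_mul, norm_mul (iq p _)]
      gcongr <;> apply hC
  have l2 : Tendsto (fun n : ℕ => qP p (2 * n)) atTop (𝓝 (qInf p)) :=
    (qP_tendsto hp).comp (tendsto_id.const_mul_atTop' (by norm_num))
  have l3 := l2.mul l1
  simp_rw [jt_finite hp0 hp hz] at l3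
  have l4 := h1.tendsto_prod_tprod_nat.mul h2.tendsto_prod_tprod_nat
  have h := tendsto_nhds_unique l3 l4
  rw [tsum_mul_right] at h
  have h5 := qInf_ne_zero hp
  rw [← h]
  field_simp

/-- theta series -/
def th (q : ℂ) (K s : ℤ) : ℂ := ∑' r : ℤ, (-1) ^ r * q ^ (K * tri r + s * r)

lemma th_summable {q : ℂ} (hq0 : q ≠ 0) (hq : ‖q‖ < 1) {K : ℤ} (hK : 1 ≤ K) (s : ℤ) :
    Summable fun r : ℤ => ‖q ^ (K * tri r + s * r)‖ := by
  have := sumZ_of (norm_pos_iff.mpr hq0) hq _ _ (tri_bound K hK s)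
  simpa [norm_zpow] using this

lemma neg_one_zpow_neg (r : ℤ) : (-1 : ℂ) ^ (-r) = (-1) ^ r := by
  rw [zpow_neg]
  rcases Int.even_or_odd r with h | h <;> simp [h.neg_one_zpow]

lemma th_neg {q : ℂ} (hq0 : q ≠ 0) (K s : ℤ) : th q K (-s) = - q ^ (-s) * th q K s := by
  unfold th
  rw [← (Equiv.subLeft (1 : ℤ)).tsum_eq, ← tsum_mul_left]
  refine tsum_congr fun r => ?_
  simp only [Equiv.subLeft_apply]
  have hm1 : (-1 : ℂ) ≠ 0 := by norm_num
  have e1 : K * tri (1 - r) + -s * (1 - r) = -s + (K * tri r + s * r) := by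
    have : tri (1 - r) = tri r := by
      have h1 := two_tri r
      have h2 := two_tri (1 - r)
      linarith
    rw [this]; ring
  rw [e1, zpow_add₀ hq0 (-s), sub_eq_add_neg, zpow_add₀ hm1, neg_one_zpow_neg, zpow_one]
  ring

lemma th_shift {q : ℂ} (hq0 : q ≠ 0) (K s j : ℤ) :
    th q K (s - 2 * j * K) = q ^ (-(j * ((2 * j + 1) * K - 2 * s))) * th q K s := by
  unfold th
  rw [← (Equiv.addRight (2 * j : ℤ)).tsum_eq, ← tsum_mul_left]
  refine tsum_congr fun r => ?_
  simp only [Equiv.coe_addRight]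
  have hm1 : (-1 : ℂ) ≠ 0 := by norm_num
  have e1 : K * tri (r + 2 * j) + (s - 2 * j * K) * (r + 2 * j)
      = -(j * ((2 * j + 1) * K - 2 * s)) + (K * tri r + s * r) := by
    have : tri (r + 2 * j) = tri r + 2 * j * r + j * (2 * j - 1) := by
      have h1 := two_tri r
      have h2 := two_tri (r + 2 * j)
      linarith
    rw [this]; ring
  rw [e1, zpow_add₀ hq0 _ (K * tri r + s * r), zpow_add₀ hm1, zpow_mul (-1 : ℂ) 2 j]
  norm_num
  ring

lemma th_shift_neg {q : ℂ} (hq0 : q ≠ 0) (K s j : ℤ) :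
    th q K (-s - 2 * j * K) = - q ^ (-((2 * j + 1) * (K * j + s))) * th q K s := by
  have h1 := th_neg hq0 K (s - 2 * (-j) * K)
  rw [th_shift hq0, ← mul_assoc, neg_mul, ← zpow_add₀ hq0] at h1
  convert h1 using 2
  · ring
  · congr 2; ring

lemma th_zero {q : ℂ} (hq0 : q ≠ 0) (K j : ℤ) : th q K (K * j) = 0 := by
  -- `-Kj = Kj - 2jK`
  have h1 := th_neg hq0 K (K * j)
  have h2 := th_shift hq0 K (K * j) j
  have e1 : K * j - 2 * j * K = -(K * j) := by ring
  have e2 : -(j * ((2 * j + 1) * K - 2 * (K * j))) = -(K * j) := by ring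
  rw [e1, e2, h1] at h2
  have h3 := zpow_ne_zero (-(K * j)) hq0
  have h4 : q ^ (-(K * j)) * th q K (K * j) = 0 := by linear_combination -h2 / 2
  exact (mul_eq_zero.mp h4).resolve_left h3

/-- indicator factor -/
def fac (q : ℂ) (P : ℕ → Prop) (j : ℕ) : ℂ := if P j then 1 - q ^ j else 1

lemma fac_multipliable {q : ℂ} (hq : ‖q‖ < 1) (P : ℕ → Prop) : Multipliable (fac q P) := by
  have h : fac q P = fun j => 1 + (if P j then - q ^ j else 0) := by
    funext j
    unfold fac
    split_ifs <;> ring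
  rw [h]
  apply multipliable_one_add_of_summable
  refine Summable.of_nonneg_of_le (fun _ => norm_nonneg _) (fun j => ?_)
    (summable_geometric_of_lt_one (norm_nonneg q) hq)
  split_ifs
  · simp
  · simp

lemma fac_tprod_inj (q : ℂ) (P : ℕ → Prop) (g : ℕ → ℕ) (hg : Function.Injective g)
    (h1 : ∀ i, P (g i)) (h2 : ∀ j, P j → ∃ i, g i = j) :
    ∏' i, (1 - q ^ (g i)) = ∏' j, fac q P j := by
  have := Function.Injective.tprod_eq hg (f := fac q P) (by
    intro j hj
    apply h2
    by_contra h
    apply hj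
    simp [fac, h])
  rw [← this]
  refine tprod_congr fun i => ?_
  simp [fac, h1]

lemma fac_tprod_subtype (q : ℂ) (P : ℕ → Prop) :
    ∏' j : {j : ℕ // P j}, (1 - q ^ (j : ℕ)) = ∏' j, fac q P j := by
  have := tprod_subtype {j | P j} (fun j : ℕ => 1 - q ^ j)
  refine this.trans (tprod_congr fun j => ?_)
  simp [fac, Set.mulIndicator]

lemma product_side {q : ℂ} (hq0 : q ≠ 0) (hq : ‖q‖ < 1) (ν s : ℕ) (hs1 : 1 ≤ s)
    (hs2 : s ≤ 2 * ν + 2) :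
    qInf q = th q (2 * (ν : ℤ) + 3) s * ∏' j : {j : ℕ // 1 ≤ j ∧ (j : ZMod (2 * ν + 3)) ≠ 0 ∧
            (j : ZMod (2 * ν + 3)) ≠ (s : ZMod (2 * ν + 3)) ∧
            (j : ZMod (2 * ν + 3)) ≠ -(s : ZMod (2 * ν + 3))},
          (1 - q ^ (j : ℕ)) := by
  set K := 2 * ν + 3 with hK
  have z0 : ∀ j : ℕ, ((j : ZMod K) = 0) ↔ K ∣ j := fun j => ZMod.natCast_eq_zero_iff j K
  have z1 : ∀ j : ℕ, ((j : ZMod K) = (s : ZMod K)) ↔ j % K = s := fun j => by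
    rw [ZMod.natCast_eq_natCast_iff, Nat.ModEq, Nat.mod_eq_of_lt (show s < K by omega)]
  have z2 : ∀ j : ℕ, ((j : ZMod K) = -(s : ZMod K)) ↔ K ∣ j + s := fun j => by
    rw [eq_neg_iff_add_eq_zero, ← Nat.cast_add, ZMod.natCast_eq_zero_iff]
  rw [fac_tprod_subtype]
  have hpred : (fun j : ℕ => 1 ≤ j ∧ (j : ZMod K) ≠ 0 ∧ (j : ZMod K) ≠ (s : ZMod K) ∧
      (j : ZMod K) ≠ -(s : ZMod K)) = fun j : ℕ => 1 ≤ j ∧ ¬ K ∣ j ∧ ¬ j % K = s ∧ ¬ K ∣ j + s := by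
    funext j
    rw [ne_eq, ne_eq, ne_eq, z0, z1, z2]
  rw [hpred]
  clear z0 z1 z2 hpred
  -- the theta function as a product
  have hp0 : q ^ K ≠ 0 := pow_ne_zero _ hq0
  have hp : ‖q ^ K‖ < 1 := by
    rw [norm_pow]; exact pow_lt_one₀ (norm_nonneg _) hq (by omega)
  have hz : q ^ s ≠ 0 := pow_ne_zero _ hq0
  have hexp : ∀ r : ℤ, (q ^ s) ^ r * (q ^ K) ^ (tri r) = q ^ ((2 * (ν : ℤ) + 3) * tri r + s * r) := by
    intro r
    rw [← zpow_natCast q s, ← zpow_natCast q K, ← zpow_mul, ← zpow_mul, ← zpow_add₀ hq0]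
    congr 1
    rw [hK]; push_cast; ring
  have ea : ∀ i : ℕ, q ^ s * (q ^ K) ^ i = q ^ (s + K * i) := by
    intro i; rw [← pow_mul, ← pow_add]
  have eb : ∀ i : ℕ, (q ^ K) ^ (i + 1) * (q ^ s)⁻¹ = q ^ (K * (i + 1) - s) := by
    intro i
    rw [← pow_mul, pow_sub₀ q hq0]
    nlinarith
  have ec : ∀ i : ℕ, (q ^ K) ^ (i + 1) = q ^ (K * (i + 1)) := by
    intro i; rw [← pow_mul]
  have pa : ∏' i : ℕ, (1 - q ^ (s + K * i)) = ∏' j, fac q (fun j => j % K = s) j := by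
    apply fac_tprod_inj q _ (fun i => s + K * i)
    · intro a b h
      change s + K * a = s + K * b at h
      exact Nat.eq_of_mul_eq_mul_left (show 0 < K by omega) (by omega)
    · intro i
      simp only [Nat.add_mul_mod_self_left]
      exact Nat.mod_eq_of_lt (by omega)
    · intro j hj
      refine ⟨j / K, ?_⟩
      have := Nat.mod_add_div j K
      omega
  have pb : ∏' i : ℕ, (1 - q ^ (K * (i + 1) - s)) = ∏' j, fac q (fun j => K ∣ j + s) j := by
    apply fac_tprod_inj q _ (fun i => K * (i + 1) - s)
    · intro a b h
      change K * (a + 1) - s = K * (b + 1) - s at h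
      have h1 : s ≤ K * (a + 1) := by nlinarith
      have h2 : s ≤ K * (b + 1) := by nlinarith
      have h3 : K * (a + 1) = K * (b + 1) := by omega
      have := Nat.eq_of_mul_eq_mul_left (show 0 < K by omega) h3
      omega
    · intro i
      have h1 : s ≤ K * (i + 1) := by nlinarith
      refine ⟨i + 1, ?_⟩
      omega
    · rintro j ⟨t, ht⟩
      have : t ≠ 0 := by rintro rfl; omega
      refine ⟨t - 1, ?_⟩
      rw [Nat.sub_add_cancel (by omega)]
      omega
  have pc : ∏' i : ℕ, (1 - q ^ (K * (i + 1))) = ∏' j, fac q (fun j => 1 ≤ j ∧ K ∣ j) j := by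
    apply fac_tprod_inj q _ (fun i => K * (i + 1))
    · intro a b h
      have := Nat.eq_of_mul_eq_mul_left (show 0 < K by omega) h
      omega
    · intro i
      exact ⟨by nlinarith, ⟨i + 1, rfl⟩⟩
    · rintro j ⟨h1, t, ht⟩
      have : t ≠ 0 := by rintro rfl; omega
      refine ⟨t - 1, ?_⟩
      rw [Nat.sub_add_cancel (by omega)]
      omega
  have pd : qInf q = ∏' j, fac q (fun j => 1 ≤ j) j := by
    apply fac_tprod_inj q _ (fun i => i + 1)
    · intro a b h
      simpa using h
    · intro i; simp
    · intro j hj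
      exact ⟨j - 1, by omega⟩
  have ma : Multipliable fun i : ℕ => 1 - q ^ s * (q ^ K) ^ i := by
    simp_rw [sub_eq_add_neg]
    apply multipliable_one_add_of_summable
    have := (summable_geometric_of_lt_one (norm_nonneg _) hp).mul_left (‖q ^ s‖)
    refine this.congr fun i => ?_
    rw [norm_neg, norm_mul, norm_pow _ i]
  have mb : Multipliable fun i : ℕ => 1 - (q ^ K) ^ (i + 1) * (q ^ s)⁻¹ := by
    simp_rw [sub_eq_add_neg]
    apply multipliable_one_add_of_summable
    have := (summable_pow_succ hp).mul_right (‖(q ^ s)⁻¹‖)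
    refine this.congr fun i => ?_
    rw [norm_neg, norm_mul]
  have hth : th q (2 * (ν : ℤ) + 3) s = qInf (q ^ K) * ((∏' i : ℕ, (1 - q ^ s * (q ^ K) ^ i)) *
      ∏' i : ℕ, (1 - (q ^ K) ^ (i + 1) * (q ^ s)⁻¹)) := by
    rw [← jtp hp0 hp hz _ ma mb]
    · unfold th
      refine tsum_congr fun r => ?_
      rw [mul_assoc, hexp]
    · simp_rw [hexp]
      exact th_summable hq0 hq (by omega) _
  rw [hth]
  unfold qInf at pd ⊢
  simp_rw [ea, eb, ec]
  rw [pa, pb, pc, pd]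
  have mf := fun P => fac_multipliable hq P
  rw [← (mf _).tprod_mul (mf _), ← (mf _).tprod_mul ((mf _).mul (mf _)),
    ← ((mf _).mul ((mf _).mul (mf _))).tprod_mul (mf _)]
  refine tprod_congr fun j => ?_
  unfold fac
  by_cases h0 : j = 0
  · subst h0
    have : ¬ K ∣ s := fun h => by have := Nat.le_of_dvd (by omega) h; omega
    simp [this]
    omega
  have hj : 1 ≤ j := by omega
  have hs' : ¬ K ∣ s := fun h => by have := Nat.le_of_dvd (by omega) h; omega
  have hm := Nat.mod_lt j (show 0 < K by omega)
  have d0 : K ∣ j ↔ j % K = 0 := Nat.dvd_iff_mod_eq_zero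
  have d1 : K ∣ j + s ↔ j % K = K - s := by
    have hd := Nat.mod_add_div j K
    constructor
    · intro h
      have h2 : K ∣ j % K + s := by
        have : j + s = (j % K + s) + K * (j / K) := by omega
        rw [this] at h
        exact (Nat.dvd_add_left ⟨_, rfl⟩).mp h
      obtain ⟨t, ht⟩ := h2
      have : t = 1 := by
        have h3 : 0 < t := by
          rcases Nat.eq_zero_or_pos t with h | h
          · subst h; omega
          · exact h
        have h4 : t < 2 := by
          by_contra h5
          have : K * 2 ≤ K * t := Nat.mul_le_mul_left _ (by omega)
          omega
        omega
      subst this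
      omega
    · intro h
      refine ⟨j / K + 1, ?_⟩
      rw [mul_add]
      omega
  simp only [d0, d1, hj, true_and, if_true]
  obtain ⟨m, hm'⟩ : ∃ m, j % K = m := ⟨_, rfl⟩
  simp only [hm'] at hm ⊢
  rcases Nat.eq_zero_or_pos m with h | h
  · subst h
    rw [if_pos rfl, if_neg (by omega), if_neg (by omega), if_neg (by simp)]
    ring
  · by_cases h1 : m = s
    · rw [if_neg (by omega), if_pos h1, if_neg (by omega), if_neg (by omega)]; ring
    · by_cases h2 : m = K - s
      · rw [if_neg (by omega), if_neg h1, if_pos h2, if_neg (by omega)]; ring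
      · rw [if_neg (by omega), if_neg h1, if_neg h2, if_pos (by omega)]; ring

lemma lhs_term (q : ℂ) (hq0 : q ≠ 0) {ν : ℕ} (M : ℕ) (nn : Fin ν → ℕ) :
    q ^ ((∑ i ∈ Finset.Icc 1 ν, (NN nn i : ℤ) ^ 2) - (M : ℤ) * (NN nn 1 : ℤ)) /
        ∏ i : Fin ν, qP q (nn i)
      = (fun N : ℕ => q ^ ((N : ℤ) ^ 2 - (M : ℤ) * N)) (NN nn 1) * bw q nn := by
  have h := e2_one nn
  have h' : (∑ i ∈ Finset.Icc 1 ν, (NN nn i : ℤ) ^ 2) = (NN nn 1 : ℤ) ^ 2 + (e2 nn : ℤ) := by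
    exact_mod_cast h
  have e : (NN nn 1 : ℤ) ^ 2 + (e2 nn : ℤ) - (M : ℤ) * (NN nn 1 : ℤ)
    = ((NN nn 1 : ℤ) ^ 2 - (M : ℤ) * (NN nn 1 : ℤ)) + (e2 nn : ℤ) := by ring
  rw [h', e, zpow_add₀ hq0, zpow_natCast]
  simp only [bw, iq_nat, Finset.prod_inv_distrib]
  rw [div_eq_mul_inv, mul_assoc]

lemma qB_symm {F : Type*} [Field F] (q : F) (N : ℕ) (k : ℤ) :
    qB q (N : ℤ) (N - k) = qB q (N : ℤ) k := by
  rw [qB_eq, qB_eq, sub_sub_cancel]; ring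

lemma reflect_tsum (F : ℤ → ℂ) (M : ℤ) : ∑' r, F (M - r) = ∑' r, F r :=
  (Equiv.subLeft M).tsum_eq F

lemma main_one {q : ℂ} (hq0 : q ≠ 0) (hq : ‖q‖ < 1) (ν M : ℕ) :
    ∑' nn : Fin ν → ℕ,
      q ^ ((∑ i ∈ Finset.Icc 1 ν, (NN nn i : ℤ) ^ 2) - (M : ℤ) * (NN nn 1 : ℤ)) /
        ∏ i : Fin ν, qP q (nn i)
      = (qInf q)⁻¹ * ∑' i : ℤ, qB q⁻¹ (M : ℤ) i * th q (2 * (ν : ℤ) + 3) (ν + 1 + M - 2 * i) := by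
  have hq0' : 0 < ‖q‖ := norm_pos_iff.mpr hq0
  rw [tsum_congr (lhs_term q hq0 M), chain hq0 hq ν (fun N : ℕ => q ^ ((N : ℤ) ^ 2 - (M : ℤ) * N))
    (‖q‖ ^ (-(|(M : ℤ)| + 1) ^ 2))]
  swap
  · intro N
    rw [norm_zpow, ← zpow_natCast ‖q‖ N, ← zpow_add₀ hq0'.ne']
    apply zpow_le_zpow_right_of_le_one₀ hq0' hq.le
    have := quad_bound M N
    rw [abs_of_nonneg (by positivity : (0 : ℤ) ≤ N)] at this
    linarith
  rw [← tsum_int_nat (f := fun m : ℤ => q ^ (m ^ 2 - (M : ℤ) * m) * bet q ν m)]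
  swap
  · intro m hm
    rw [bet_neg q ν hm, mul_zero]
  set f : ℤ → ℤ → ℂ := fun m r => q ^ (m ^ 2 - (M : ℤ) * m) * ((-1) ^ r *
    q ^ ((2 * ν + 1) * tri r + ν * r) * (iq q (m - r) * iq q (m + r))) with hf
  have hs : Summable (Function.uncurry f) := by
    obtain ⟨u, hu, hu0, h⟩ := bet_summand_bdd hq0 hq ν
    have h1 := sumZ_of hq0' hq _ _ (quad_bound M)
    refine Summable.of_norm_bounded (h1.mul_of_nonneg hu (fun _ => by positivity) hu0) ?_
    rintro ⟨m, r⟩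
    simp only [Function.uncurry, hf]
    rw [norm_mul (q ^ _), norm_zpow]
    gcongr
    exact h m r
  have h1 : ∀ m : ℤ, q ^ (m ^ 2 - (M : ℤ) * m) * bet q ν m = ∑' r, f m r := by
    intro m
    simp only [hf, bet, tsum_mul_left]
  rw [tsum_congr h1, ← hs.tsum_comm]
  have h2 : ∀ r, ∑' m, f m r = (qInf q)⁻¹ * ∑ j ∈ Finset.Icc (0 : ℤ) M, qB q⁻¹ (M : ℤ) j *
      ((-1) ^ r * q ^ ((2 * (ν : ℤ) + 3) * tri r + (ν + 1 - M + 2 * j) * r)) := by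
    intro r
    have h3 : ∀ m, f m r = (-1) ^ r * q ^ ((2 * ν + 1) * tri r + ν * r) *
        (q ^ (m ^ 2 - (r + -r + (M : ℤ)) * m) * (iq q (m - r) * iq q (m - -r))) := by
      intro m
      simp only [hf]
      rw [add_neg_cancel, zero_add, sub_neg_eq_add]
      ring
    rw [tsum_congr h3, tsum_mul_left, E_formula hq0 hq M r (-r), tsum_eq_sum (s := Finset.Icc (0 : ℤ) M)]
    · rw [mul_left_comm, Finset.mul_sum]
      congr 1
      refine Finset.sum_congr rfl fun j _ => ?_
      have e : (2 * (ν : ℤ) + 3) * tri r + (ν + 1 - M + 2 * j) * r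
        = ((2 * ν + 1) * tri r + ν * r) + (-((r + j) * -r) - r * (M - j)) := by
        linear_combination two_tri r
      rw [e, zpow_add₀ hq0 _ (-((r + j) * -r) - r * (M - j))]
      ring
    · intro j hj
      rw [Finset.mem_Icc] at hj
      rw [qB_eq, mul_assoc (qP q⁻¹ M), iq_mul_zero (by omega)]; simp
  have hths : ∀ σ, Summable fun r : ℤ => (-1) ^ r * q ^ ((2 * (ν : ℤ) + 3) * tri r + σ * r) := by
    intro σ
    refine Summable.of_norm ?_
    refine (th_summable hq0 hq (K := 2 * (ν : ℤ) + 3) (by omega) σ).congr fun r => ?_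
    rw [norm_mul, norm_zpow (-1 : ℂ), norm_neg, norm_one, one_zpow, one_mul]
  rw [tsum_congr h2, tsum_mul_left, Summable.tsum_finsetSum (fun j _ => (hths _).mul_left _)]
  congr 1
  have h4 := reflect_tsum
    (fun i => qB q⁻¹ (M : ℤ) i * th q (2 * (ν : ℤ) + 3) (ν + 1 + M - 2 * i)) M
  rw [← h4, tsum_eq_sum (s := Finset.Icc (0 : ℤ) M)]
  · refine Finset.sum_congr rfl fun j _ => ?_
    rw [qB_symm, tsum_mul_left, th]
    have e : (ν : ℤ) + 1 - M + 2 * j = ν + 1 + M - 2 * (M - j) := by ring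
    rw [e]
  · intro j hj
    rw [Finset.mem_Icc] at hj
    rw [qB_eq, mul_assoc (qP q⁻¹ M), iq_mul_zero (by omega)]; simp

lemma residue_tsum (F : ℤ → ℂ) (c K : ℤ) (hK : K ≠ 0) :
    ∑' j : ℤ, F (c + j * K) = ∑' i : ℤ, if K ∣ i - c then F i else 0 := by
  have hinj : Function.Injective fun j : ℤ => c + j * K := by
    intro a b h
    simp only [add_right_inj] at h
    exact mul_right_cancel₀ hK h
  have := hinj.tsum_eq (f := fun i : ℤ => if K ∣ i - c then F i else 0) (by
    intro i hi
    by_contra h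
    apply hi
    have : ¬ K ∣ i - c := by
      rintro ⟨t, ht⟩
      exact h ⟨t, by simp only; rw [mul_comm]; omega⟩
    simp only [if_neg this])
  rw [← this]
  refine tsum_congr fun j => ?_
  simp

lemma qB_icc {f : ℤ → ℂ} (q : ℂ) (M : ℕ) (P : ℤ → Prop) [DecidablePred P] :
    Summable fun i : ℤ => if P i then qB q (M : ℤ) i * f i else 0 := by
  apply summable_icc 0 M
  intro m hm
  rw [qB_eq, mul_assoc (qP q M), iq_mul_zero (by omega)]; simp

lemma B_mul_th {q : ℂ} (hq0 : q ≠ 0) (ν M s : ℕ) (hpar : ¬ (M : ℤ) ≡ (ν : ℤ) + s [ZMOD 2]) :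
    B ν (s : ℤ) ((ν : ℤ) + 1) M q⁻¹ * th q (2 * (ν : ℤ) + 3) s
      = ∑' i : ℤ, ((if 2 * (2 * (ν : ℤ) + 3) ∣ ν + 1 + M - 2 * i - s then
          qB q⁻¹ (M : ℤ) i * th q (2 * (ν : ℤ) + 3) (ν + 1 + M - 2 * i) else 0) +
          (if 2 * (2 * (ν : ℤ) + 3) ∣ ν + 1 + M - 2 * i + s then
          qB q⁻¹ (M : ℤ) i * th q (2 * (ν : ℤ) + 3) (ν + 1 + M - 2 * i) else 0)) := by
  set F : ℤ → ℂ := fun i => qB q⁻¹ (M : ℤ) i * th q (2 * (ν : ℤ) + 3) (ν + 1 + M - 2 * i) with hF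
  set K : ℤ := 2 * (ν : ℤ) + 3 with hK
  have hK0 : K ≠ 0 := by omega
  obtain ⟨c1, hc1⟩ : ∃ c1, ((M : ℤ) + (ν + 1) - s) / 2 = c1 := ⟨_, rfl⟩
  obtain ⟨c2, hc2⟩ : ∃ c2, ((M : ℤ) + (ν + 1) + s) / 2 = c2 := ⟨_, rfl⟩
  have hpar' : ((M : ℤ) + (ν + 1) - s) % 2 = 0 ∧ ((M : ℤ) + (ν + 1) + s) % 2 = 0 := by
    unfold Int.ModEq at hpar
    omega
  have hc1' : 2 * c1 = (M : ℤ) + (ν + 1) - s := by omega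
  have hc2' : 2 * c2 = (M : ℤ) + (ν + 1) + s := by omega
  have d1 : ∀ i, (2 * K ∣ ν + 1 + M - 2 * i - s) ↔ K ∣ i - c1 := by
    intro i
    rw [show (ν : ℤ) + 1 + M - 2 * i - s = 2 * (-(i - c1)) by linarith,
      mul_dvd_mul_iff_left two_ne_zero, dvd_neg]
  have d2 : ∀ i, (2 * K ∣ ν + 1 + M - 2 * i + s) ↔ K ∣ i - c2 := by
    intro i
    rw [show (ν : ℤ) + 1 + M - 2 * i + s = 2 * (-(i - c2)) by linarith,
      mul_dvd_mul_iff_left two_ne_zero, dvd_neg]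
  simp only [d1, d2]
  have hFz : ∀ i : ℤ, i < 0 ∨ (M : ℤ) < i → qB q⁻¹ (M : ℤ) i = 0 := by
    intro i hi
    rw [qB_eq, mul_assoc (qP q⁻¹ M), iq_mul_zero (by omega)]; simp
  have sup : ∀ c : ℤ, (Function.support fun j : ℤ => qB q⁻¹ (M : ℤ) (c + j * K)).Finite := by
    intro c
    refine Set.Finite.subset (s := (fun j : ℤ => c + j * K) ⁻¹' (Finset.Icc (0 : ℤ) M : Set ℤ)) ?_ ?_
    · refine Set.Finite.preimage ?_ (Finset.finite_toSet _)
      intro a _ b _ h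
      simp only [add_right_inj] at h
      exact mul_right_cancel₀ hK0 h
    · intro j hj
      by_contra h
      apply hj
      apply hFz
      simp only [Set.mem_preimage, Finset.coe_Icc, Set.mem_Icc] at h
      omega
  have sup' : ∀ (c : ℤ) (w : ℤ → ℂ),
      (Function.support fun j : ℤ => w j * qB q⁻¹ (M : ℤ) (c + j * K)).Finite := by
    intro c w
    refine (sup c).subset ?_
    intro j hj h
    exact hj (by simp only at h ⊢; rw [h, mul_zero])
  unfold B
  rw [← hK, hc1, hc2, ← tsum_eq_finsum (L := SummationFilter.unconditional ℤ), ← tsum_mul_right]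
  swap
  · exact ((sup' c1 _).union (sup' c2 _)).subset (Function.support_sub _ _)
  have h1 : ∀ j : ℤ, (q⁻¹ ^ (j * ((2 * j + 1) * K - 2 * s)) * qB q⁻¹ (M : ℤ) (c1 + j * K) -
      q⁻¹ ^ ((2 * j + 1) * (K * j + s)) * qB q⁻¹ (M : ℤ) (c2 + j * K)) * th q K s
      = F (c1 + j * K) + F (c2 + j * K) := by
    intro j
    simp only [hF]
    have e1 : (ν : ℤ) + 1 + M - 2 * (c1 + j * K) = s - 2 * j * K := by linear_combination -hc1'
    have e2 : (ν : ℤ) + 1 + M - 2 * (c2 + j * K) = -s - 2 * j * K := by linear_combination -hc2'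
    rw [e1, e2, th_shift hq0, th_shift_neg hq0, inv_zpow', inv_zpow']
    ring
  rw [tsum_congr h1]
  have sF : ∀ c : ℤ, Summable fun j : ℤ => F (c + j * K) := by
    intro c
    apply summable_of_finite_support
    refine (sup c).subset ?_
    intro j hj h
    apply hj
    simp only [hF] at h ⊢
    rw [h, zero_mul]
  rw [(sF c1).tsum_add (sF c2), residue_tsum F c1 K hK0, residue_tsum F c2 K hK0,
    Summable.tsum_add (qB_icc _ _ _) (qB_icc _ _ _)]

lemma count_one {q : ℂ} (hq0 : q ≠ 0) (ν M : ℕ) (i : ℤ) (y : ℂ) :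
    ∑ s ∈ (Finset.Icc 1 (2 * ν + 2)).filter (fun s : ℕ => ¬ (M : ℤ) ≡ (ν : ℤ) + s [ZMOD 2]),
      ((if 2 * (2 * (ν : ℤ) + 3) ∣ ν + 1 + M - 2 * i - s then
          y * th q (2 * (ν : ℤ) + 3) (ν + 1 + M - 2 * i) else 0) +
          (if 2 * (2 * (ν : ℤ) + 3) ∣ ν + 1 + M - 2 * i + s then
          y * th q (2 * (ν : ℤ) + 3) (ν + 1 + M - 2 * i) else 0))
      = y * th q (2 * (ν : ℤ) + 3) (ν + 1 + M - 2 * i) := by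
  set K : ℤ := 2 * (ν : ℤ) + 3 with hK
  obtain ⟨σ, hσ⟩ : ∃ σ : ℤ, (ν : ℤ) + 1 + M - 2 * i = σ := ⟨_, rfl⟩
  rw [hσ]
  have hdiv := Int.emod_add_mul_ediv σ (2 * K)
  have hlo := Int.emod_nonneg σ (show 2 * K ≠ 0 by omega)
  have hhi := Int.emod_lt_of_pos σ (show 0 < 2 * K by omega)
  obtain ⟨t, ht⟩ : ∃ t, σ / (2 * K) = t := ⟨_, rfl⟩
  rw [ht] at hdiv
  generalize hρ : σ % (2 * K) = ρ at *
  by_cases hz : ρ = 0 ∨ ρ = K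
  · have : th q K σ = 0 := by
      rcases hz with h | h
      · rw [← hdiv, h, show 0 + 2 * K * t = K * (2 * t) by ring]
        exact th_zero hq0 _ _
      · rw [← hdiv, h, show K + 2 * K * t = K * (1 + 2 * t) by ring]
        exact th_zero hq0 _ _
    simp [this]
  have dm : ∀ s : ℕ, 1 ≤ s → s ≤ 2 * ν + 2 → (2 * K ∣ σ - s ↔ ρ = s) := by
    intro s h1 h2
    rw [← hdiv, show ρ + 2 * K * t - s = (ρ - s) + 2 * K * t by ring,
      dvd_add_left ⟨t, rfl⟩]
    constructor
    · intro h
      have := Int.eq_zero_of_abs_lt_dvd h (by rw [abs_lt]; constructor <;> omega)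
      omega
    · intro h; rw [h, sub_self]; exact dvd_zero _
  have dp : ∀ s : ℕ, 1 ≤ s → s ≤ 2 * ν + 2 → (2 * K ∣ σ + s ↔ ρ = 2 * K - s) := by
    intro s h1 h2
    rw [← hdiv, show ρ + 2 * K * t + s = (ρ + s - 2 * K) + 2 * K * (t + 1) by ring,
      dvd_add_left ⟨t + 1, rfl⟩]
    constructor
    · intro h
      have := Int.eq_zero_of_abs_lt_dvd h (by rw [abs_lt]; constructor <;> omega)
      omega
    · intro h; rw [h]; ring_nf; exact dvd_zero _
  have hparity : (ρ - σ) % 2 = 0 := by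
    rw [← hdiv, show ρ - (ρ + 2 * K * t) = 2 * (-(K * t)) by ring]
    exact Int.mul_emod_right _ _
  rcases lt_or_gt_of_ne (fun h => hz (Or.inr h) : ρ ≠ K) with h | h
  · obtain ⟨s0, hs0⟩ : ∃ s0 : ℕ, (s0 : ℤ) = ρ := ⟨ρ.toNat, by omega⟩
    have hmem : s0 ∈ (Finset.Icc 1 (2 * ν + 2)).filter
        (fun s : ℕ => ¬ (M : ℤ) ≡ (ν : ℤ) + s [ZMOD 2]) := by
      rw [Finset.mem_filter, Finset.mem_Icc]
      unfold Int.ModEq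
      refine ⟨by omega, by omega⟩
    rw [Finset.sum_eq_single_of_mem s0 hmem]
    · rw [Finset.mem_filter, Finset.mem_Icc] at hmem
      rw [if_pos ((dm s0 hmem.1.1 hmem.1.2).mpr hs0.symm), if_neg, add_zero]
      rw [dp s0 hmem.1.1 hmem.1.2]
      omega
    · intro s hs hne
      rw [Finset.mem_filter, Finset.mem_Icc] at hs
      rw [if_neg, if_neg, add_zero]
      · rw [dp s hs.1.1 hs.1.2]; omega
      · rw [dm s hs.1.1 hs.1.2]; omega
  · obtain ⟨s0, hs0⟩ : ∃ s0 : ℕ, (s0 : ℤ) = 2 * K - ρ := ⟨(2 * K - ρ).toNat, by omega⟩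
    have hmem : s0 ∈ (Finset.Icc 1 (2 * ν + 2)).filter
        (fun s : ℕ => ¬ (M : ℤ) ≡ (ν : ℤ) + s [ZMOD 2]) := by
      rw [Finset.mem_filter, Finset.mem_Icc]
      unfold Int.ModEq
      refine ⟨by omega, by omega⟩
    rw [Finset.sum_eq_single_of_mem s0 hmem]
    · rw [Finset.mem_filter, Finset.mem_Icc] at hmem
      rw [if_pos ((dp s0 hmem.1.1 hmem.1.2).mpr (by omega)), if_neg, zero_add]
      rw [dm s0 hmem.1.1 hmem.1.2]
      omega
    · intro s hs hne
      rw [Finset.mem_filter, Finset.mem_Icc] at hs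
      rw [if_neg, if_neg, add_zero]
      · rw [dp s hs.1.1 hs.1.2]; omega
      · rw [dm s hs.1.1 hs.1.2]; omega

lemma sum_lift (ν M : ℕ) (f : ℤ → ℂ) :
    ∑ s ∈ (Finset.Icc 1 (2 * ν + 2)).filter (fun s => ¬ (M : ℤ) ≡ (ν : ℤ) + s [ZMOD 2]), f s
      = ∑ s ∈ (Finset.Icc 1 (2 * ν + 2)).filter (fun s : ℕ => ¬ (M : ℤ) ≡ (ν : ℤ) + s [ZMOD 2]),
        f (s : ℤ) := by
  symm
  refine Finset.sum_nbij (fun s : ℕ => (s : ℤ)) ?_ ?_ ?_ ?_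
  · intro s hs
    rw [Finset.mem_filter] at hs ⊢
    refine ⟨?_, hs.2⟩
    simp only [Finset.bind_def, Finset.pure_def, Finset.mem_sup, Finset.mem_singleton]
    exact ⟨s, hs.1, rfl⟩
  · intro s _ t _ h
    exact Int.ofNat_inj.mp h
  · intro s hs
    rw [Finset.mem_coe, Finset.mem_filter] at hs
    obtain ⟨h1, h2⟩ := hs
    simp only [Finset.bind_def, Finset.pure_def, Finset.mem_sup, Finset.mem_singleton] at h1
    obtain ⟨t, ht, rfl⟩ := h1
    exact ⟨t, by rw [Finset.mem_coe, Finset.mem_filter]; exact ⟨ht, h2⟩, rfl⟩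
  · intro s _
    rfl

end

theorem stmt_10 (ν : ℕ) (hν : 1 ≤ ν) (M : ℕ) (q : ℂ) (hq0 : q ≠ 0) (hq : ‖q‖ < 1) :
    ∑' nn : Fin ν → ℕ,
      q ^ ((∑ i ∈ Finset.Icc 1 ν, (NN nn i : ℤ) ^ 2) - (M : ℤ) * (NN nn 1 : ℤ)) /
        ∏ i : Fin ν, qP q (nn i) =
    ∑ s ∈ (Finset.Icc 1 (2 * ν + 2)).filter (fun s => ¬ (M : ℤ) ≡ (ν : ℤ) + s [ZMOD 2]),
      B ν (s : ℤ) ((ν : ℤ) + 1) M q⁻¹ /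
        ∏' j : {j : ℕ // 1 ≤ j ∧ (j : ZMod (2 * ν + 3)) ≠ 0 ∧
            (j : ZMod (2 * ν + 3)) ≠ (s : ZMod (2 * ν + 3)) ∧
            (j : ZMod (2 * ν + 3)) ≠ -(s : ZMod (2 * ν + 3))},
          (1 - q ^ (j : ℕ)) := by
  rw [main_one hq0 hq, sum_lift]
  have h1 : ∑' i : ℤ, qB q⁻¹ (M : ℤ) i * th q (2 * (ν : ℤ) + 3) (ν + 1 + M - 2 * i)
      = ∑ s ∈ (Finset.Icc 1 (2 * ν + 2)).filter (fun s : ℕ => ¬ (M : ℤ) ≡ (ν : ℤ) + s [ZMOD 2]),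
        B ν (s : ℤ) ((ν : ℤ) + 1) M q⁻¹ * th q (2 * (ν : ℤ) + 3) s := by
    rw [tsum_congr fun i => (count_one hq0 ν M i (qB q⁻¹ (M : ℤ) i)).symm,
      Summable.tsum_finsetSum (fun s _ => (qB_icc _ _ _).add (qB_icc _ _ _))]
    refine Finset.sum_congr rfl fun s hs => ?_
    rw [B_mul_th hq0 ν M s (Finset.mem_filter.mp hs).2]
  rw [h1, Finset.mul_sum]
  refine Finset.sum_congr rfl fun s hs => ?_
  have hs' := Finset.mem_Icc.mp (Finset.mem_filter.mp hs).1
  have hp := product_side hq0 hq ν s hs'.1 hs'.2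
  rw [show (s : ZMod (2 * ν + 3)) = ((s : ℤ) : ZMod (2 * ν + 3)) from
    (Int.cast_natCast s).symm] at hp
  have hne := qInf_ne_zero hq
  rw [hp] at hne
  have h2 := left_ne_zero_of_mul hne
  have h3 := right_ne_zero_of_mul hne
  rw [hp]
  field_simp

end
end

section
/- (Warnaar) For all integers ν ≥ 1, 0 ≤ s, b ≤ ν, and L ≥ 0, the following identity of polynomials in q holds: G^ν_{0,L}(ν−s,b,q) = W^ν_{s+1,b}(L,q) if b + s ≡ ν(L+1) (mod 2), and G^ν_{0,L}(ν−s,b,q) = W^ν_{2ν+2−s,b}(L,q) if b + s ≢ ν(L+1) (mod 2). -/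
open scoped Classical

noncomputable section

/-! ### Basic facts about q-binomials -/

section Aux

variable {F : Type*} [Field F] {q : F}

/-- `q` is nonzero and not a root of unity. -/
def Gen (q : F) : Prop := q ≠ 0 ∧ ∀ n : ℕ, 1 - q ^ (n + 1) ≠ 0

lemma qP_ne (hq : Gen q) (n : ℕ) : qP q n ≠ 0 :=
  Finset.prod_ne_zero_iff.mpr fun j _ => hq.2 j

lemma qP_succ (n : ℕ) : qP q (n + 1) = qP q n * (1 - q ^ (n + 1)) :=
  Finset.prod_range_succ _ _

lemma qB_add (n k : ℕ) : qB q ((n + k : ℕ) : ℤ) (k : ℤ) = qP q (n + k) / (qP q k * qP q n) := by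
  unfold qB
  rw [if_pos (by constructor <;> push_cast <;> omega)]
  have h1 : (((n + k : ℕ) : ℤ)).toNat = n + k := by simp only [Int.toNat_natCast]
  have h2 : (((n + k : ℕ) : ℤ) - (k : ℤ)).toNat = n := by push_cast; simp
  rw [h1, h2, Int.toNat_natCast]

lemma qB_gt {n k : ℕ} (h : n < k) : qB q (n : ℤ) (k : ℤ) = 0 := by
  unfold qB
  rw [if_neg (by omega)]

lemma qB_self (hq : Gen q) (n : ℕ) : qB q (n : ℤ) (n : ℤ) = 1 := by
  have := qB_add (q := q) 0 n
  rw [zero_add] at this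
  rw [this]
  have h0 : qP q 0 = 1 := by simp [qP]
  rw [h0, mul_one]
  exact div_self (qP_ne hq n)

lemma qB_zero (hq : Gen q) (n : ℕ) : qB q (n : ℤ) ((0 : ℕ) : ℤ) = 1 := by
  have := qB_add (q := q) n 0
  rw [add_zero] at this
  rw [this]
  have h0 : qP q 0 = 1 := by simp [qP]
  rw [h0, one_mul]
  exact div_self (qP_ne hq n)

/-- absorption -/
lemma qB_abs1 (hq : Gen q) (L n : ℕ) :
    (1 - q ^ (n + 1)) * qB q ((L + 1 : ℕ) : ℤ) ((n + 1 : ℕ) : ℤ)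
      = (1 - q ^ (L + 1)) * qB q (L : ℤ) (n : ℤ) := by
  rcases lt_or_ge L n with h | h
  · rw [qB_gt h, qB_gt (by omega)]; simp
  · obtain ⟨t, rfl⟩ := Nat.exists_eq_add_of_le' h
    rw [qB_add, show t + n + 1 = t + (n + 1) by ring, qB_add, ← add_assoc, qP_succ, qP_succ]
    have := qP_ne hq n
    have := qP_ne hq t
    have := hq.2 n
    field_simp

lemma qB_abs2 (hq : Gen q) (L k : ℕ) :
    (1 - q ^ ((L : ℤ) + 1 - k)) * qB q ((L + 1 : ℕ) : ℤ) (k : ℤ)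
      = (1 - q ^ (L + 1)) * qB q (L : ℤ) (k : ℤ) := by
  rcases lt_trichotomy k (L + 1) with h | h | h
  · obtain ⟨t, rfl⟩ := Nat.exists_eq_add_of_le' (Nat.lt_succ_iff.mp h)
    rw [qB_add, show t + k + 1 = (t + 1) + k by ring, qB_add,
      show ((t + k : ℕ) : ℤ) + 1 - k = ((t + 1 : ℕ) : ℤ) by push_cast; ring, zpow_natCast,
      qP_succ t, show t + 1 + k = t + k + 1 by ring, qP_succ]
    have := qP_ne hq k
    have := qP_ne hq t
    have := hq.2 t
    field_simp
  · subst h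
    rw [qB_gt (Nat.lt_succ_self L)]
    simp
  · rw [qB_gt h, qB_gt (by omega)]; simp

lemma qB_pascal_s11 (hq : Gen q) (L n : ℕ) :
    qB q ((L + 1 : ℕ) : ℤ) ((n + 1 : ℕ) : ℤ)
      = q ^ (n + 1) * qB q (L : ℤ) ((n + 1 : ℕ) : ℤ) + qB q (L : ℤ) (n : ℤ) := by
  have h1 := qB_abs1 hq L n
  have h2 := qB_abs2 hq L (n + 1)
  have h3 : q ^ (n + 1) * q ^ ((L : ℤ) + 1 - ((n + 1 : ℕ) : ℤ)) = q ^ (L + 1) := by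
    rw [← zpow_natCast, ← zpow_natCast, ← zpow_add₀ hq.1]
    congr 1; push_cast; ring
  apply mul_left_cancel₀ (hq.2 L)
  linear_combination h1 + q ^ (n + 1) * h2 + qB q ((L + 1 : ℕ) : ℤ) ((n + 1 : ℕ) : ℤ) * h3

/-! ### The operator raising `ν` by one -/

/-- the operator raising `ν` by one -/
def thE (q : F) (f : ℕ → ℤ → F) (L : ℕ) (a : ℤ) : F :=
  ∑ k ∈ Finset.range (L + 1),
    q ^ (((L : ℤ) - k) * (a - k)) * qB q (L : ℤ) (k : ℤ) * f k (a - k)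

/-- `q`-multinomials, recursively in `ν`. -/
def EE (q : F) : ℕ → ℕ → ℕ → ℤ → F
  | 0, _, _, a => if a = 0 then 1 else 0
  | ν + 1, p, L, a =>
    if p ≤ ν then thE q (EE q ν p) L a
    else thE q (fun k y => q ^ (-(k : ℤ)) * EE q ν ν k y) L a

/-- partial sums. -/
def AA (q : F) (ν c L : ℕ) (a : ℤ) : F :=
  ∑ m ∈ Finset.range c, q ^ ((m : ℤ) * L) * EE q ν m L (a - m)

lemma AA_succ (ν c L : ℕ) (a : ℤ) :
    AA q ν (c + 1) L a = AA q ν c L a + q ^ ((c : ℤ) * L) * EE q ν c L (a - c) :=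
  Finset.sum_range_succ _ _

lemma EE_le {ν p : ℕ} (h : p ≤ ν) (L : ℕ) (a : ℤ) :
    EE q (ν + 1) p L a = thE q (EE q ν p) L a := by
  rw [EE, if_pos h]

lemma EE_top (ν : ℕ) (L : ℕ) (a : ℤ) :
    EE q (ν + 1) (ν + 1) L a = thE q (fun k y => q ^ (-(k : ℤ)) * EE q ν ν k y) L a := by
  rw [EE, if_neg (by omega)]

lemma thE_congr {f g : ℕ → ℤ → F} (h : ∀ k y, f k y = g k y) (L : ℕ) (a : ℤ) :
    thE q f L a = thE q g L a := by
  unfold thE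
  simp only [h]

lemma thE_sub (f g : ℕ → ℤ → F) (L : ℕ) (a : ℤ) :
    thE q f L a - thE q g L a = thE q (fun k y => f k y - g k y) L a := by
  unfold thE
  rw [← Finset.sum_sub_distrib]
  exact Finset.sum_congr rfl fun k _ => by ring

lemma thE_zero (hq : Gen q) (f : ℕ → ℤ → F) (a : ℤ) : thE q f 0 a = f 0 a := by
  unfold thE
  have := qB_zero hq 0
  simp at this
  simp [this]

lemma thE_L1 (hq : Gen q) (f : ℕ → ℤ → F) (L : ℕ) (a : ℤ) :
    thE q (fun k y => (1 - q ^ k) * f k y) (L + 1) a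
      = (1 - q ^ (L + 1)) * thE q (fun n y => f (n + 1) y) L (a - 1) := by
  unfold thE
  rw [Finset.sum_range_succ', Finset.mul_sum]
  simp only [pow_zero, sub_self, zero_mul, mul_zero, add_zero]
  refine Finset.sum_congr rfl fun n _ => ?_
  have h1 := qB_abs1 hq L n
  have e1 : (((L + 1 : ℕ) : ℤ) - ((n + 1 : ℕ) : ℤ)) * (a - ((n + 1 : ℕ) : ℤ))
      = ((L : ℤ) - n) * (a - 1 - n) := by push_cast; ring
  have e2 : a - ((n + 1 : ℕ) : ℤ) = a - 1 - n := by push_cast; ring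
  rw [e1, e2]
  linear_combination q ^ (((L : ℤ) - n) * (a - 1 - n)) * f (n + 1) (a - 1 - n) * h1

lemma thE_L2 (hq : Gen q) (f : ℕ → ℤ → F) (L : ℕ) (a : ℤ) :
    thE q f (L + 1) a = q ^ a * thE q f L a + thE q (fun n y => f (n + 1) y) L (a - 1) := by
  unfold thE
  have h0 : ∀ k : ℕ, q ^ ((((L + 1 : ℕ) : ℤ) - k) * (a - k)) * q ^ k
      = q ^ a * q ^ (((L : ℤ) - k) * (a - k)) := by
    intro k
    rw [← zpow_natCast, ← zpow_add₀ hq.1, ← zpow_add₀ hq.1]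
    congr 1; push_cast; ring
  have hS : ∑ k ∈ Finset.range (L + 1),
      q ^ (((L : ℤ) - k) * (a - k)) * qB q (L : ℤ) (k : ℤ) * f k (a - k)
      = ∑ k ∈ Finset.range (L + 2),
      q ^ (((L : ℤ) - k) * (a - k)) * qB q (L : ℤ) (k : ℤ) * f k (a - k) := by
    rw [Finset.sum_range_succ _ (L + 1), qB_gt (Nat.lt_succ_self L)]; simp
  rw [hS, Finset.sum_range_succ', Finset.sum_range_succ' _ (L + 1), mul_add, Finset.mul_sum,
    qB_zero hq, qB_zero hq, add_right_comm, ← Finset.sum_add_distrib]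
  congr 1
  · refine Finset.sum_congr rfl fun n _ => ?_
    have e1 : (((L + 1 : ℕ) : ℤ) - ((n + 1 : ℕ) : ℤ)) * (a - ((n + 1 : ℕ) : ℤ))
      = ((L : ℤ) - n) * (a - 1 - n) := by push_cast; ring
    have e2 : a - ((n + 1 : ℕ) : ℤ) = a - 1 - n := by push_cast; ring
    have h := h0 (n + 1)
    rw [qB_pascal_s11 hq]
    rw [e1] at h ⊢
    rw [e2] at h ⊢
    linear_combination qB q (L : ℤ) ((n + 1 : ℕ) : ℤ) * f (n + 1) (a - 1 - n) * h
  · have h := h0 0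
    rw [pow_zero] at h
    linear_combination f 0 (a - (0 : ℕ)) * h

lemma thE_L3 (hq : Gen q) (f : ℕ → ℤ → F) (L : ℕ) (a : ℤ) :
    thE q (fun k y => (1 - q ^ ((L : ℤ) + 1 - k)) * f k y) (L + 1) a
      = (1 - q ^ (L + 1)) * thE q (fun k y => q ^ y * f k y) L a := by
  unfold thE
  rw [Finset.sum_range_succ _ (L + 1), Finset.mul_sum]
  have : (1 : F) - q ^ ((L : ℤ) + 1 - ((L + 1 : ℕ) : ℤ)) = 0 := by
    rw [show (L : ℤ) + 1 - ((L + 1 : ℕ) : ℤ) = 0 by push_cast; ring, zpow_zero, sub_self]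
  beta_reduce
  rw [this, zero_mul, mul_zero, add_zero]
  refine Finset.sum_congr rfl fun k _ => ?_
  have h1 := qB_abs2 hq L k
  have h0 : q ^ ((((L + 1 : ℕ) : ℤ) - k) * (a - k))
      = q ^ (((L : ℤ) - k) * (a - k)) * q ^ (a - k) := by
    rw [← zpow_add₀ hq.1]
    congr 1; push_cast; ring
  rw [h0]
  linear_combination q ^ (((L : ℤ) - k) * (a - k)) * q ^ (a - k) * f k (a - k) * h1

lemma thE_AA (hq : Gen q) {ν c : ℕ} (hc : c ≤ ν + 1) (L : ℕ) (a : ℤ) :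
    thE q (AA q ν c) L a = AA q (ν + 1) c L a := by
  unfold thE AA
  simp only [Finset.mul_sum]
  rw [Finset.sum_comm]
  refine Finset.sum_congr rfl fun m hm => ?_
  rw [EE_le (by have := Finset.mem_range.mp hm; omega)]
  unfold thE
  rw [Finset.mul_sum]
  refine Finset.sum_congr rfl fun n _ => ?_
  have h0 : q ^ (((L : ℤ) - n) * (a - n)) * q ^ ((m : ℤ) * n)
      = q ^ ((m : ℤ) * L) * q ^ (((L : ℤ) - n) * (a - m - n)) := by
    rw [← zpow_add₀ hq.1, ← zpow_add₀ hq.1]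
    congr 1; ring
  rw [show a - n - m = a - m - n by ring]
  linear_combination qB q (L : ℤ) (n : ℤ) * EE q ν m n (a - m - n) * h0

lemma thE_L5 (hq : Gen q) (t : ℤ) (g : ℕ → ℤ → F) (L : ℕ) (a : ℤ) :
    thE q (fun n y => q ^ (t * ((n : ℤ) + 1) - y) * g n (y - t - 1)) L (a - 1)
      = q ^ ((t + 1) * ((L : ℤ) + 1) - a) * thE q g L (a - t - 2) := by
  unfold thE
  rw [Finset.mul_sum]
  refine Finset.sum_congr rfl fun n _ => ?_
  have h0 : q ^ (((L : ℤ) - n) * (a - 1 - n)) * q ^ (t * ((n : ℤ) + 1) - (a - 1 - n))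
      = q ^ ((t + 1) * ((L : ℤ) + 1) - a) * q ^ (((L : ℤ) - n) * (a - t - 2 - n)) := by
    rw [← zpow_add₀ hq.1, ← zpow_add₀ hq.1]
    congr 1; ring
  beta_reduce
  rw [show a - 1 - (n : ℤ) - t - 1 = a - t - 2 - n by ring]
  linear_combination qB q (L : ℤ) (n : ℤ) * g n (a - t - 2 - n) * h0

lemma EE_L0 (hq : Gen q) (ν p : ℕ) (a : ℤ) : EE q ν p 0 a = if a = 0 then 1 else 0 := by
  induction ν generalizing p with
  | zero => rw [EE]
  | succ ν ih =>
    rw [EE, thE_zero hq, thE_zero hq]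
    simp [ih]

lemma EE_bot (hq : Gen q) (ν L : ℕ) (a : ℤ) : q ^ a * EE q ν ν L a = EE q ν 0 L a := by
  induction ν generalizing L a with
  | zero =>
    simp only [EE]
    split_ifs with h
    · simp [h]
    · simp
  | succ ν ih =>
    rw [EE_top, EE_le (Nat.zero_le _)]
    unfold thE
    rw [Finset.mul_sum]
    refine Finset.sum_congr rfl fun k _ => ?_
    rw [← ih]
    have h0 : q ^ a * q ^ (-(k : ℤ)) = q ^ (a - k) := by
      rw [← zpow_add₀ hq.1]; rfl
    linear_combination q ^ (((L : ℤ) - k) * (a - k)) * qB q (L : ℤ) (k : ℤ) *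
      EE q ν ν k (a - k) * h0

/-! ### The system of recurrences -/

lemma AA_one (ν L : ℕ) (a : ℤ) : AA q ν 1 L a = EE q ν 0 L a := by
  simp [AA]

/-- first recurrence -/
def SysP' (q : F) (ν : ℕ) : Prop := ∀ p t : ℕ, p + t + 1 = ν → ∀ (L : ℕ) (a : ℤ),
  EE q ν p (L + 1) a - EE q ν (p + 1) (L + 1) a
    = -((1 - q ^ (L + 1)) * (q ^ ((t : ℤ) * ((L : ℤ) + 1) - a) * AA q ν (p + 1) L (a - t - 1)))

/-- recurrence `P` -/
def SysP (q : F) (ν L : ℕ) : Prop := ∀ p t : ℕ, p + t + 1 = ν → ∀ (a : ℤ),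
  EE q ν p (L + 1) a - q ^ (L + 1) * EE q ν (p + 1) (L + 1) a
    = (1 - q ^ (L + 1)) * AA q ν (t + 1) L a

/-- recurrence `Q` -/
def SysQ (q : F) (ν L : ℕ) : Prop := ∀ r t : ℕ, r + t = ν → ∀ (a : ℤ),
  AA q ν (r + 1) L a = AA q ν r L (a - 1) + q ^ a * EE q ν t L a

/-- recurrence `R0` -/
def SysR (q : F) (ν : ℕ) : Prop := ∀ (L : ℕ) (a : ℤ), EE q ν 0 (L + 1) a = AA q ν (ν + 1) L a

lemma sysP'_succ (hq : Gen q) {ν : ℕ} (hR : SysR q ν) (hP' : SysP' q ν) : SysP' q (ν + 1) := by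
  intro p t hpt L a
  rcases t with _ | t
  · obtain rfl : p = ν := by omega
    rw [EE_le le_rfl, EE_top, thE_sub]
    have h1 : ∀ (k : ℕ) (y : ℤ), EE q p p k y - q ^ (-(k : ℤ)) * EE q p p k y
        = (1 - q ^ k) * (-(q ^ (-(k : ℤ)) * EE q p p k y)) := by
      intro k y
      have : q ^ k * q ^ (-(k : ℤ)) = 1 := by
        rw [← zpow_natCast, ← zpow_add₀ hq.1]; simp
      linear_combination (- EE q p p k y) * this
    rw [thE_congr h1, thE_L1 hq]
    have h2 : ∀ (n : ℕ) (y : ℤ), -(q ^ (-((n + 1 : ℕ) : ℤ)) * EE q p p (n + 1) y)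
        = q ^ ((-1 : ℤ) * ((n : ℤ) + 1) - y) * (fun n y => - AA q p (p + 1) n y) n (y - (-1) - 1) := by
      intro n y
      beta_reduce
      rw [show y - (-1) - 1 = y by ring, ← hR, ← EE_bot hq]
      have : q ^ ((-1 : ℤ) * ((n : ℤ) + 1) - y) * q ^ y = q ^ (-((n + 1 : ℕ) : ℤ)) := by
        rw [← zpow_add₀ hq.1]; congr 1; push_cast; ring
      linear_combination EE q p p (n + 1) y * this
    rw [thE_congr h2, thE_L5 hq (-1) (fun n y => - AA q p (p + 1) n y)]
    have h3 := thE_AA hq (le_refl (p + 1)) L (a - (-1) - 2)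
    have h4 : thE q (fun n y => - AA q p (p + 1) n y) L (a - (-1) - 2)
        = - thE q (AA q p (p + 1)) L (a - (-1) - 2) := by
      unfold thE; rw [← Finset.sum_neg_distrib]
      exact Finset.sum_congr rfl fun k _ => by ring
    rw [h4, h3, show a - (-1) - 2 = a - ((0 : ℕ) : ℤ) - 1 by push_cast; ring]
    push_cast
    ring_nf
  · have hpt' : p + t + 1 = ν := by omega
    rw [EE_le (by omega), EE_le (by omega), thE_sub]
    have h1 : ∀ (k : ℕ) (y : ℤ), EE q ν p k y - EE q ν (p + 1) k y
        = (1 - q ^ k) * (-(q ^ ((t : ℤ) * (((k - 1 : ℕ) : ℤ) + 1) - y)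
          * AA q ν (p + 1) (k - 1) (y - t - 1))) := by
      intro k y
      rcases k with _ | k
      · rw [EE_L0 hq, EE_L0 hq]; simp
      · rw [hP' p t hpt' k y]; simp
    rw [thE_congr h1, thE_L1 hq]
    have h2 : ∀ (n : ℕ) (y : ℤ), -(q ^ ((t : ℤ) * (((n + 1 - 1 : ℕ) : ℤ) + 1) - y)
          * AA q ν (p + 1) (n + 1 - 1) (y - t - 1))
        = q ^ ((t : ℤ) * ((n : ℤ) + 1) - y) * (fun n y => - AA q ν (p + 1) n y) n (y - t - 1) := by
      intro n y
      simp
    rw [thE_congr h2, thE_L5 hq t (fun n y => - AA q ν (p + 1) n y)]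
    have h3 := thE_AA hq (show p + 1 ≤ ν + 1 by omega) L (a - t - 2)
    have h4 : thE q (fun n y => - AA q ν (p + 1) n y) L (a - t - 2)
        = - thE q (AA q ν (p + 1)) L (a - t - 2) := by
      unfold thE; rw [← Finset.sum_neg_distrib]
      exact Finset.sum_congr rfl fun k _ => by ring
    rw [h4, h3, show a - t - 2 = a - ((t + 1 : ℕ) : ℤ) - 1 by push_cast; ring]
    push_cast
    ring_nf

lemma sysP_succ (hq : Gen q) {ν : ℕ} (hP : ∀ L, SysP q ν L) {L : ℕ} (hQ : SysQ q (ν + 1) L) :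
    SysP q (ν + 1) L := by
  intro p t hpt a
  rcases t with _ | t
  · obtain rfl : p = ν := by omega
    rw [EE_le le_rfl, EE_top]
    have h0 : thE q (EE q p p) (L + 1) a
        - q ^ (L + 1) * thE q (fun k y => q ^ (-(k : ℤ)) * EE q p p k y) (L + 1) a
        = thE q (fun k y => (1 - q ^ ((L : ℤ) + 1 - k)) * EE q p p k y) (L + 1) a := by
      unfold thE
      rw [Finset.mul_sum, ← Finset.sum_sub_distrib]
      refine Finset.sum_congr rfl fun k _ => ?_
      have : q ^ ((L : ℤ) + 1 - k) = q ^ (L + 1) * q ^ (-(k : ℤ)) := by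
        rw [← zpow_natCast, ← zpow_add₀ hq.1]; congr 1
      beta_reduce
      rw [this]; ring
    rw [h0, thE_L3 hq, zero_add, AA_one, EE_le (Nat.zero_le _)]
    rw [thE_congr (fun k y => EE_bot hq p k y)]
  · have hpt' : p + t + 1 = ν := by omega
    have hQ' := hQ (t + 1) (p + 1) (by omega) a
    rw [hQ', EE_le (by omega), EE_le (by omega), EE_le (by omega)]
    have h1 : ∀ (k : ℕ) (y : ℤ), EE q ν p k y
        = (1 - q ^ k) * AA q ν (t + 1) (k - 1) y + EE q ν (p + 1) k y
          - (1 - q ^ k) * EE q ν (p + 1) k y := by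
      intro k y
      rcases k with _ | k
      · rw [EE_L0 hq, EE_L0 hq]; simp
      · have := hP k p t hpt' y
        simp only [Nat.add_sub_cancel]
        linear_combination this
    rw [thE_congr h1, ← thE_sub]
    have h2 : thE q (fun k y => (1 - q ^ k) * AA q ν (t + 1) (k - 1) y + EE q ν (p + 1) k y) (L + 1) a
        = thE q (fun k y => (1 - q ^ k) * AA q ν (t + 1) (k - 1) y) (L + 1) a
          + thE q (EE q ν (p + 1)) (L + 1) a := by
      unfold thE
      rw [← Finset.sum_add_distrib]
      exact Finset.sum_congr rfl fun k _ => by ring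
    have h3 := thE_L1 hq (fun k y => AA q ν (t + 1) (k - 1) y) L a
    simp only [Nat.add_sub_cancel] at h3
    have h4 := thE_AA hq (show t + 1 ≤ ν + 1 by omega) L (a - 1)
    have h5 := thE_L1 hq (fun k y => EE q ν (p + 1) k y) L a
    have h6 := thE_L2 hq (EE q ν (p + 1)) L a
    have h7 : thE q (fun n y => AA q ν (t + 1) n y) L (a - 1) = AA q (ν + 1) (t + 1) L (a - 1) := h4
    rw [h2, h3, h5, h7]
    linear_combination (1 - q ^ (L + 1)) * h6

lemma sysQ_zero (hq : Gen q) (ν : ℕ) : SysQ q ν 0 := by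
  intro r t _ a
  unfold AA
  rw [Finset.sum_range_succ']
  simp only [EE_L0 hq]
  congr 1
  · refine Finset.sum_congr rfl fun m _ => ?_
    rw [show a - ((m + 1 : ℕ) : ℤ) = a - 1 - m by push_cast; ring]
    simp
  · by_cases h : a = 0 <;> simp [h]

lemma sysQ_succ (hq : Gen q) {ν L : ℕ} (hP : SysP q ν L) (hP' : SysP' q ν) : SysQ q ν (L + 1) := by
  intro r
  induction r with
  | zero =>
    intro t ht a
    obtain rfl : t = ν := by omega
    rw [zero_add, AA_one, EE_bot hq]
    simp [AA]
  | succ r ih =>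
    intro t ht a
    have h1 := ih (t + 1) (by omega) a
    have h2 := hP' t r (by omega) L a
    have h3 := hP r t (by omega) (a - r - 1)
    rw [AA_succ, h1, AA_succ _ r]
    have e1 : q ^ (((r + 1 : ℕ) : ℤ) * ((L + 1 : ℕ) : ℤ)) = q ^ ((r : ℤ) * ((L + 1 : ℕ) : ℤ)) * q ^ (L + 1) := by
      rw [← zpow_natCast q (L + 1), ← zpow_add₀ hq.1]; congr 1; push_cast; ring
    have e2 : q ^ a * q ^ ((r : ℤ) * ((L : ℤ) + 1) - a) = q ^ ((r : ℤ) * ((L + 1 : ℕ) : ℤ)) := by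
      rw [← zpow_add₀ hq.1]; congr 1; push_cast; ring
    rw [e1, show a - ((r + 1 : ℕ) : ℤ) = a - r - 1 by push_cast; ring,
      show a - 1 - (r : ℤ) = a - r - 1 by ring]
    linear_combination (- q ^ a) * h2 - q ^ ((r : ℤ) * ((L + 1 : ℕ) : ℤ)) * h3 +
      (1 - q ^ (L + 1)) * AA q ν (t + 1) L (a - r - 1) * e2

/-- all the recurrences -/
lemma sys_all (hq : Gen q) (ν : ℕ) :
    SysP' q ν ∧ SysR q ν ∧ (∀ L, SysP q ν L) ∧ (∀ L, SysQ q ν L) := by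
  induction ν with
  | zero =>
    have hP' : SysP' q 0 := by intro p t h; omega
    have hP : ∀ L, SysP q 0 L := by intro L p t h; omega
    refine ⟨hP', ?_, hP, ?_⟩
    · intro L a
      rw [zero_add, AA_one]; rfl
    · intro L
      cases L with
      | zero => exact sysQ_zero hq 0
      | succ L => exact sysQ_succ hq (hP L) hP'
  | succ ν ih =>
    obtain ⟨hP', hR, hP, hQ⟩ := ih
    have h1 := sysP'_succ hq hR hP'
    have h2 : ∀ L, SysQ q (ν + 1) L := by
      intro L
      induction L with
      | zero => exact sysQ_zero hq _
      | succ L ih => exact sysQ_succ hq (sysP_succ hq hP ih) h1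
    refine ⟨h1, ?_, fun L => sysP_succ hq hP (h2 L), h2⟩
    intro L a
    have h3 := h2 L (ν + 1) 0 (by omega) a
    rw [h3, EE_le (Nat.zero_le _), EE_le (Nat.zero_le _), thE_L2 hq]
    have h4 := thE_AA hq (le_refl (ν + 1)) L (a - 1)
    rw [thE_congr (fun n y => hR n y)]
    have h5 : thE q (fun n y => AA q ν (ν + 1) n y) L (a - 1) = AA q (ν + 1) (ν + 1) L (a - 1) := h4
    rw [h5]; ring

lemma EE_rec (hq : Gen q) (ν L : ℕ) : ∀ b r : ℕ, b + r = ν → ∀ a : ℤ,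
    EE q ν b (L + 1) a = AA q ν (r + 1) L a
      + q ^ ((r : ℤ) * ((L : ℤ) + 1) - a) * AA q ν b L (a - r - 1) := by
  obtain ⟨hP', hR, hP, hQ⟩ := sys_all hq ν
  intro b
  induction b with
  | zero =>
    intro r hr a
    obtain rfl : r = ν := by omega
    rw [hR]; simp [AA]
  | succ b ih =>
    intro r hr a
    have h1 := ih (r + 1) (by omega) a
    have h2 := hP' b r (by omega) L a
    have h3 := hQ L b (r + 1) (by omega) (a - r - 1)
    have e1 : q ^ (((r + 1 : ℕ) : ℤ) * ((L : ℤ) + 1) - a)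
        = q ^ ((r : ℤ) * ((L : ℤ) + 1) - a) * q ^ (L + 1) := by
      rw [← zpow_natCast q (L + 1), ← zpow_add₀ hq.1]; congr 1; push_cast; ring
    have e2 : q ^ (((r + 1 : ℕ) : ℤ) * (L : ℤ))
        = q ^ ((r : ℤ) * ((L : ℤ) + 1) - a) * q ^ (L + 1) * q ^ (a - r - 1) := by
      rw [← zpow_natCast q (L + 1), ← zpow_add₀ hq.1, ← zpow_add₀ hq.1]; congr 1; push_cast; ring
    rw [AA_succ, e1, e2, show a - ((r + 1 : ℕ) : ℤ) = a - r - 1 by push_cast; ring] at h1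
    rw [show a - (r : ℤ) - 1 - 1 = a - r - 1 - 1 by ring] at h3
    linear_combination h1 - h2 +
      q ^ ((r : ℤ) * ((L : ℤ) + 1) - a) * q ^ (L + 1) * (-h3)

/-- symmetry of `EE` and `AA` -/
lemma sym_all (hq : Gen q) (ν L : ℕ) :
    (∀ b r : ℕ, b + r = ν → ∀ a : ℤ,
      EE q ν b L a = q ^ ((r : ℤ) * L - a) * EE q ν r L (ν * L - a)) ∧
    (∀ c : ℕ, c ≤ ν + 1 → ∀ a : ℤ, AA q ν c L a = AA q ν c L (ν * L + c - 1 - a)) := by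
  have hQA := (sys_all hq ν).2.2.2 L
  have key : (∀ b r : ℕ, b + r = ν → ∀ a : ℤ,
      EE q ν b L a = q ^ ((r : ℤ) * L - a) * EE q ν r L (ν * L - a)) →
    (∀ c : ℕ, c ≤ ν + 1 → ∀ a : ℤ, AA q ν c L a = AA q ν c L (ν * L + c - 1 - a)) := by
    intro hS c
    induction c with
    | zero => intro _ a; simp [AA]
    | succ c ih =>
      intro hc a
      obtain ⟨t, ht⟩ := Nat.exists_eq_add_of_le (show c ≤ ν by omega)
      have h1 := hQA c t ht.symm (ν * L + ((c + 1 : ℕ) : ℤ) - 1 - a)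
      rw [h1, AA_succ, ih (by omega) a]
      have h2 := hS c t ht.symm (a - c)
      rw [h2, show (ν : ℤ) * L + ((c + 1 : ℕ) : ℤ) - 1 - a - 1 = ν * L + c - 1 - a by push_cast; ring,
        show (ν : ℤ) * L + ((c + 1 : ℕ) : ℤ) - 1 - a = ν * L - (a - c) by push_cast; ring, ← mul_assoc,
        ← zpow_add₀ hq.1]
      congr 3
      rw [ht]; push_cast; ring
  suffices h : (∀ b r : ℕ, b + r = ν → ∀ a : ℤ,
      EE q ν b L a = q ^ ((r : ℤ) * L - a) * EE q ν r L (ν * L - a)) from ⟨h, key h⟩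
  clear key hQA
  induction L with
  | zero =>
    intro b r hbr a
    rw [EE_L0 hq, EE_L0 hq]
    by_cases h : a = 0 <;> simp [h]
  | succ L ihS =>
    have hQ := (sys_all hq ν).2.2.2 L
    have ihA : (∀ c : ℕ, c ≤ ν + 1 → ∀ a : ℤ, AA q ν c L a = AA q ν c L (ν * L + c - 1 - a)) := by
      intro c
      induction c with
      | zero => intro _ a; simp [AA]
      | succ c ih =>
        intro hc a
        obtain ⟨t, ht⟩ := Nat.exists_eq_add_of_le (show c ≤ ν by omega)
        have h1 := hQ c t ht.symm (ν * L + ((c + 1 : ℕ) : ℤ) - 1 - a)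
        rw [h1, AA_succ, ih (by omega) a]
        have h2 := ihS c t ht.symm (a - c)
        rw [h2, show (ν : ℤ) * L + ((c + 1 : ℕ) : ℤ) - 1 - a - 1 = ν * L + c - 1 - a by push_cast; ring,
          show (ν : ℤ) * L + ((c + 1 : ℕ) : ℤ) - 1 - a = ν * L - (a - c) by push_cast; ring, ← mul_assoc,
          ← zpow_add₀ hq.1]
        congr 3
        rw [ht]; push_cast; ring
    intro b r hbr a
    have hν : (ν : ℤ) = b + r := by rw [← hbr]; push_cast; ring
    rw [EE_rec hq ν L b r hbr a, EE_rec hq ν L r b (by omega)]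
    rw [ihA (b + 1) (by omega) (ν * ((L + 1 : ℕ) : ℤ) - a), ihA r (by omega) (ν * ((L + 1 : ℕ) : ℤ) - a - b - 1)]
    rw [show (ν : ℤ) * L + ((b + 1 : ℕ) : ℤ) - 1 - (ν * ((L + 1 : ℕ) : ℤ) - a) = a - r by
      rw [hν]; push_cast; ring]
    rw [show (ν : ℤ) * L + r - 1 - (ν * ((L + 1 : ℕ) : ℤ) - a - b - 1) = a by
      rw [hν]; push_cast; ring]
    rw [hQ b r hbr, AA_succ]
    have e1 : q ^ ((r : ℤ) * ((L : ℤ) + 1) - a) * q ^ (a - r) = q ^ ((r : ℤ) * L) := by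
      rw [← zpow_add₀ hq.1]; congr 1; ring
    have e2 : q ^ ((r : ℤ) * ((L : ℤ) + 1) - a)
        * q ^ ((b : ℤ) * ((L : ℤ) + 1) - (ν * ((L + 1 : ℕ) : ℤ) - a)) = 1 := by
      rw [← zpow_add₀ hq.1, ← zpow_zero q]; congr 1; rw [hν]; push_cast; ring
    rw [show (r : ℤ) * ((L + 1 : ℕ) : ℤ) - a = r * ((L : ℤ) + 1) - a by push_cast; ring]
    linear_combination (- EE q ν r L (a - r)) * e1 - AA q ν r L a * e2

lemma EE_supp (hq : Gen q) (ν : ℕ) : ∀ (p L : ℕ) (a : ℤ), (a < 0 ∨ (ν : ℤ) * L < a) →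
    EE q ν p L a = 0 := by
  induction ν with
  | zero =>
    intro p L a h
    rw [EE, if_neg]
    rintro rfl
    simp at h
  | succ ν ih =>
    intro p L a h
    have key : ∀ p : ℕ, ∀ k ∈ Finset.range (L + 1), EE q ν p k (a - k) = 0 := by
      intro p k hk
      have hk : k ≤ L := by have := Finset.mem_range.mp hk; omega
      apply ih
      rcases h with h | h
      · left; omega
      · right
        push_cast at h
        have : (ν : ℤ) * k ≤ ν * L := by
          apply mul_le_mul_of_nonneg_left _ (by positivity)
          exact_mod_cast hk
        have : (k : ℤ) ≤ L := by exact_mod_cast hk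
        linarith
    rw [EE]
    split_ifs
    · unfold thE
      exact Finset.sum_eq_zero fun k hk => by rw [key _ k hk, mul_zero]
    · unfold thE
      exact Finset.sum_eq_zero fun k hk => by beta_reduce; rw [key _ k hk, mul_zero, mul_zero]

lemma AA_supp (hq : Gen q) (ν c L : ℕ) (a : ℤ) (h : a < 0 ∨ (ν : ℤ) * L + c < a) :
    AA q ν c L a = 0 := by
  unfold AA
  refine Finset.sum_eq_zero fun m hm => ?_
  have := Finset.mem_range.mp hm
  rw [EE_supp hq, mul_zero]
  rcases h with h | h
  · left; omega
  · right; omega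

/-! ### Identification of `EE` with the q-multinomials -/

/-- the summand of the q-multinomial coefficient -/
def tt (q : F) (ν L p : ℕ) (j : Fin ν → ℕ) : F :=
  q ^ ((∑ l ∈ Finset.Icc 2 ν, jjf j (l - 1) * ((L : ℤ) - jjf j l)) -
      ∑ l ∈ Finset.Icc 1 p, jjf j l) *
    qB q (L : ℤ) (jjf j ν) * ∏ l ∈ Finset.Icc 2 ν, qB q (jjf j l) (jjf j (l - 1))

/-- append a last entry -/
def snc {ν : ℕ} (j : Fin ν → ℕ) (k : ℕ) : Fin (ν + 1) → ℕ := Fin.snoc (α := fun _ => ℕ) j k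

lemma jjf_snc_lt {ν : ℕ} (j : Fin ν → ℕ) (k l : ℕ) (h1 : 1 ≤ l) (h2 : l ≤ ν) :
    jjf (snc j k) l = jjf j l := by
  unfold jjf snc
  rw [dif_pos (by omega), dif_pos (by omega)]
  simp only [Fin.snoc]
  rw [dif_pos (by omega)]
  rfl

lemma jjf_snc_top {ν : ℕ} (j : Fin ν → ℕ) (k : ℕ) : jjf (snc j k) (ν + 1) = k := by
  unfold jjf snc
  rw [dif_pos (by omega)]
  simp [Fin.snoc]

lemma sum_jjf {ν : ℕ} (j : Fin ν → ℕ) :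
    ∑ i ∈ Finset.range ν, jjf j (i + 1) = ∑ l, (j l : ℤ) := by
  rw [Finset.sum_range]
  refine Finset.sum_congr rfl fun i _ => ?_
  simp [jjf]

lemma sum_Icc_two (f : ℕ → ℤ) (n : ℕ) :
    ∑ l ∈ Finset.Icc 2 (n + 1), f l = ∑ i ∈ Finset.range n, f (i + 2) := by
  induction n with
  | zero => simp
  | succ n ih => rw [Finset.sum_Icc_succ_top (by omega), ih, Finset.sum_range_succ]

lemma exp_snc {ν : ℕ} (j : Fin ν → ℕ) (k L : ℕ) :
    ∑ l ∈ Finset.Icc 2 (ν + 1), jjf (snc j k) (l - 1) * ((L : ℤ) - jjf (snc j k) l)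
      = ((L : ℤ) - k) * ∑ l, (j l : ℤ)
        + ∑ l ∈ Finset.Icc 2 ν, jjf j (l - 1) * ((k : ℤ) - jjf j l) := by
  cases ν with
  | zero => simp
  | succ n =>
    rw [sum_Icc_two, sum_Icc_two, ← sum_jjf, Finset.sum_range_succ,
      Finset.sum_range_succ (fun i => jjf j (i + 1)), jjf_snc_top]
    have : ∀ i ∈ Finset.range n, jjf (snc j k) (i + 2 - 1) * ((L : ℤ) - jjf (snc j k) (i + 2))
        = ((L : ℤ) - k) * jjf j (i + 1) + jjf j (i + 2 - 1) * ((k : ℤ) - jjf j (i + 2)) := by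
      intro i hi
      have := Finset.mem_range.mp hi
      rw [jjf_snc_lt j k _ (by omega) (by omega), jjf_snc_lt j k _ (by omega) (by omega),
        show i + 2 - 1 = i + 1 by omega]
      ring
    rw [Finset.sum_congr rfl this, Finset.sum_add_distrib, ← Finset.mul_sum,
      jjf_snc_lt j k _ (by omega) (by omega), show n + 2 - 1 = n + 1 by omega]
    ring

lemma prod_snc (hq : Gen q) {ν : ℕ} (j : Fin ν → ℕ) (k : ℕ) :
    ∏ l ∈ Finset.Icc 2 (ν + 1), qB q (jjf (snc j k) l) (jjf (snc j k) (l - 1))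
      = qB q (k : ℤ) (jjf j ν) * ∏ l ∈ Finset.Icc 2 ν, qB q (jjf j l) (jjf j (l - 1)) := by
  cases ν with
  | zero =>
    have := qB_zero hq k
    simpa [jjf] using this.symm
  | succ n =>
    rw [Finset.prod_Icc_succ_top (by omega), jjf_snc_top, mul_comm, Nat.add_sub_cancel,
      jjf_snc_lt j k _ (by omega) le_rfl]
    congr 1
    refine Finset.prod_congr rfl fun l hl => ?_
    have := Finset.mem_Icc.mp hl
    rw [jjf_snc_lt j k _ (by omega) (by omega), jjf_snc_lt j k _ (by omega) (by omega)]

lemma tt_snc (hq : Gen q) {ν p : ℕ} (hp : p ≤ ν) (L k : ℕ) (j : Fin ν → ℕ) :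
    tt q (ν + 1) L p (snc j k)
      = q ^ (((L : ℤ) - k) * ∑ l, (j l : ℤ)) * qB q (L : ℤ) (k : ℤ) * tt q ν k p j := by
  unfold tt
  rw [exp_snc, prod_snc hq, jjf_snc_top]
  have h : ∑ l ∈ Finset.Icc 1 p, jjf (snc j k) l = ∑ l ∈ Finset.Icc 1 p, jjf j l := by
    refine Finset.sum_congr rfl fun l hl => ?_
    have := Finset.mem_Icc.mp hl
    rw [jjf_snc_lt j k _ (by omega) (by omega)]
  rw [h, add_sub_assoc, zpow_add₀ hq.1]
  ring

lemma tt_snc_top (hq : Gen q) {ν : ℕ} (L k : ℕ) (j : Fin ν → ℕ) :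
    tt q (ν + 1) L (ν + 1) (snc j k)
      = q ^ (((L : ℤ) - k) * ∑ l, (j l : ℤ)) * qB q (L : ℤ) (k : ℤ) *
        (q ^ (-(k : ℤ)) * tt q ν k ν j) := by
  unfold tt
  rw [exp_snc, prod_snc hq, jjf_snc_top]
  have h : ∑ l ∈ Finset.Icc 1 (ν + 1), jjf (snc j k) l = ∑ l ∈ Finset.Icc 1 ν, jjf j l + k := by
    rw [Finset.sum_Icc_succ_top (by omega), jjf_snc_top]
    congr 1
    refine Finset.sum_congr rfl fun l hl => ?_
    have := Finset.mem_Icc.mp hl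
    rw [jjf_snc_lt j k _ (by omega) (by omega)]
  rw [h]
  have : ∀ A B C D : ℤ, A + B - (C + D) = A + ((B - C) + (-D)) := by intros; ring
  rw [this, zpow_add₀ hq.1, zpow_add₀ hq.1]
  ring

/-- the bijection splitting off the last entry -/
def sncEquiv (ν : ℕ) : ℕ × (Fin ν → ℕ) ≃ (Fin (ν + 1) → ℕ) where
  toFun x := snc x.2 x.1
  invFun j := (j (Fin.last ν), fun i => j i.castSucc)
  left_inv x := by
    ext
    · simp [snc]
    · simp [snc]
  right_inv j := by
    ext i
    refine Fin.lastCases ?_ (fun i => ?_) i <;> simp [snc]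

lemma tt_supp (hq : Gen q) (ν : ℕ) : ∀ (L p : ℕ), p ≤ ν → ∀ j : Fin ν → ℕ, tt q ν L p j ≠ 0 →
    ∀ l, j l ≤ L := by
  induction ν with
  | zero => intro L p _ j _ l; exact l.elim0
  | succ ν ih =>
    intro L p hp j hj
    obtain ⟨⟨k, j⟩, rfl⟩ := (sncEquiv ν).surjective j
    change tt q (ν + 1) L p (snc j k) ≠ 0 at hj
    have h : qB q (L : ℤ) (k : ℤ) ≠ 0 ∧ ∃ p', p' ≤ ν ∧ tt q ν k p' j ≠ 0 := by
      rcases Nat.lt_or_ge ν p with h | h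
      · obtain rfl : p = ν + 1 := by omega
        rw [tt_snc_top hq] at hj
        refine ⟨fun h => hj (by rw [h]; ring), ν, le_rfl, fun h => hj (by rw [h]; ring)⟩
      · rw [tt_snc hq h] at hj
        refine ⟨fun h => hj (by rw [h]; ring), p, h, fun h => hj (by rw [h]; ring)⟩
    obtain ⟨h1, p', hp', h2⟩ := h
    have hk : k ≤ L := by
      by_contra hk
      exact h1 (qB_gt (by omega))
    have h3 := ih k p' hp' j h2
    intro l
    change snc j k l ≤ L
    refine Fin.lastCases ?_ (fun i => ?_) l
    · simpa [snc] using hk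
    · simpa [snc] using (h3 i).trans hk

lemma fin_box (ν L : ℕ) : {j : Fin ν → ℕ | ∀ l, j l ≤ L}.Finite := by
  have : {j : Fin ν → ℕ | ∀ l, j l ≤ L} = Set.Iic (fun _ => L) := by
    ext j; simp [Pi.le_def]
  rw [this]
  exact Set.finite_Iic _

lemma qMulti_fin (hq : Gen q) {ν p : ℕ} (hp : p ≤ ν) (L : ℕ) (a : ℤ) :
    (Function.support fun j : Fin ν → ℕ =>
      if (∑ l, (j l : ℤ)) = a then tt q ν L p j else 0).Finite := by
  refine (fin_box ν L).subset ?_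
  intro j hj
  refine tt_supp hq ν L p hp j ?_
  intro h
  apply hj
  simp [h]

lemma qMulti_eq (hq : Gen q) (ν : ℕ) : ∀ p : ℕ, p ≤ ν → ∀ (L : ℕ) (a : ℤ),
    qMulti ν L a p q = EE q ν p L a := by
  induction ν with
  | zero =>
    intro p hp L a
    obtain rfl : p = 0 := by omega
    have h := qB_zero hq L
    unfold qMulti
    rw [finsum_eq_single _ (default : Fin 0 → ℕ) (fun x hx => absurd (Subsingleton.elim x _) hx)]
    simp only [Nat.cast_zero] at h
    simp [EE, jjf, h, eq_comm]
  | succ ν ih =>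
    intro p hp L a
    have key : ∀ p' : ℕ, p' ≤ ν → ∀ w : ℕ → F,
        (∀ j k, tt q (ν + 1) L p (snc j k) = q ^ (((L : ℤ) - k) * ∑ l, (j l : ℤ)) *
          qB q (L : ℤ) (k : ℤ) * (w k * tt q ν k p' j)) →
        qMulti (ν + 1) L a p q = thE q (fun k y => w k * EE q ν p' k y) L a := by
      intro p' hp' w hw
      have h0 : qMulti (ν + 1) L a p q = ∑ᶠ j : Fin (ν + 1) → ℕ,
        if (∑ l, (j l : ℤ)) = a then tt q (ν + 1) L p j else 0 := rfl
      have hfin := qMulti_fin hq hp L a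
      rw [h0, ← finsum_comp_equiv (sncEquiv ν), finsum_curry]
      · have h1 : ∀ k : ℕ, (∑ᶠ j : Fin ν → ℕ, if (∑ l, ((sncEquiv ν (k, j) l : ℕ) : ℤ)) = a then
            tt q (ν + 1) L p (sncEquiv ν (k, j)) else 0)
            = q ^ (((L : ℤ) - k) * (a - k)) * qB q (L : ℤ) (k : ℤ) * (w k * EE q ν p' k (a - k)) := by
          intro k
          rw [← ih p' hp' k (a - k)]
          have h2 : qMulti ν k (a - k) p' q = ∑ᶠ j : Fin ν → ℕ,
            if (∑ l, (j l : ℤ)) = a - k then tt q ν k p' j else 0 := rfl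
          rw [h2, ← mul_assoc, mul_finsum]
          refine finsum_congr fun j => ?_
          have h3 : ∑ l, ((sncEquiv ν (k, j) l : ℕ) : ℤ) = ∑ l, (j l : ℤ) + k := by
            rw [Fin.sum_univ_castSucc]
            simp [sncEquiv, snc]
          rw [h3]
          by_cases hj : ∑ l, (j l : ℤ) = a - k
          · rw [if_pos hj, if_pos (by omega)]
            change tt q (ν + 1) L p (snc j k) = _
            rw [hw, hj]; ring
          · rw [if_neg hj, if_neg (by omega), mul_zero]
        rw [finsum_congr h1]
        rw [finsum_eq_sum_of_support_subset (s := Finset.range (L + 1))]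
        · rfl
        · intro k hk
          by_contra hk'
          apply hk
          simp only [Finset.coe_range, Set.mem_Iio, not_lt] at hk'
          beta_reduce
          rw [qB_gt (show L < k by omega)]
          ring
      · exact hfin.preimage (sncEquiv ν).injective.injOn
    rcases Nat.lt_or_ge ν p with h | h
    · obtain rfl : p = ν + 1 := by omega
      rw [EE_top]
      exact key ν le_rfl (fun k => q ^ (-(k : ℤ))) (fun j k => tt_snc_top hq L k j)
    · rw [EE_le h]
      rw [key p h (fun _ => 1) (fun j k => by rw [tt_snc hq h, one_mul])]
      exact thE_congr (fun k y => one_mul _) L a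

/-! ### The alternating sum as a functional -/

/-- the alternating sum as a functional -/
def WW (q : F) (K s c : ℤ) (f : ℤ → F) : F :=
  (∑ᶠ j : ℤ, q ^ (j * ((2 * j + 1) * K - 2 * s)) * f (c + K * j)) -
    ∑ᶠ j : ℤ, q ^ ((2 * j + 1) * (K * j + s)) * f (c + s + K * j)

/-- finite support -/
def BS (f : ℤ → F) : Prop := (Function.support f).Finite

lemma BS_comp {f : ℤ → F} (hf : BS f) {K : ℤ} (hK : K ≠ 0) (c : ℤ) (w : ℤ → F) :
    (Function.support fun j : ℤ => w j * f (c + K * j)).Finite := by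
  have h : ((fun j : ℤ => c + K * j) ⁻¹' Function.support f).Finite := by
    refine hf.preimage (Function.Injective.injOn ?_)
    intro x y hxy
    simpa [hK] using hxy
  refine h.subset ?_
  intro j hj hj'
  apply hj
  change w j * f (c + K * j) = 0
  rw [hj', mul_zero]

lemma BS_of {f : ℤ → F} (B : ℤ) (h : ∀ a, (a < 0 ∨ B < a) → f a = 0) : BS f := by
  refine (Set.finite_Icc 0 B).subset ?_
  intro a ha
  by_contra h'
  apply ha
  apply h
  simp only [Set.mem_Icc, not_and_or, not_le] at h'
  exact h'

lemma WW_add {K : ℤ} (hK : K ≠ 0) (s c : ℤ) {f g : ℤ → F} (hf : BS f) (hg : BS g) :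
    WW q K s c (fun a => f a + g a) = WW q K s c f + WW q K s c g := by
  unfold WW
  simp only [mul_add]
  rw [finsum_add_distrib (BS_comp hf hK _ _) (BS_comp hg hK _ _),
    finsum_add_distrib (BS_comp hf hK _ _) (BS_comp hg hK _ _)]
  ring

lemma WW_smul (K s c : ℤ) (x : F) (f : ℤ → F) :
    WW q K s c (fun a => x * f a) = x * WW q K s c f := by
  unfold WW
  rw [mul_sub, mul_finsum, mul_finsum]
  congr 1 <;> exact finsum_congr fun j => by ring

lemma WW_shift (K s c r : ℤ) (f : ℤ → F) :
    WW q K s c (fun a => f (a - r)) = WW q K s (c - r) f := by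
  unfold WW
  congr 1 <;> refine finsum_congr fun j => ?_
  · beta_reduce
    rw [show c + K * j - r = c - r + K * j by ring]
  · beta_reduce
    rw [show c + s + K * j - r = c - r + s + K * j by ring]

lemma WW_refl (K s c N : ℤ) (f : ℤ → F) :
    WW q K s c (fun a => f (N - a)) = WW q K (K - s) (N - c) f := by
  unfold WW
  congr 1
  · rw [← finsum_comp_equiv (Equiv.neg ℤ)]
    refine finsum_congr fun j => ?_
    simp only [Equiv.neg_apply]
    congr 2 <;> ring
  · rw [← finsum_comp_equiv (Equiv.subLeft (-1 : ℤ))]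
    refine finsum_congr fun j => ?_
    simp only [Equiv.subLeft_apply]
    congr 2 <;> ring

lemma WW_vanish (hq : Gen q) (K s c : ℤ) (f : ℤ → F)
    (h : ∀ a, q ^ a * f a = q ^ (2 * c + s - a) * f (2 * c + s - a)) : WW q K s c f = 0 := by
  unfold WW
  rw [sub_eq_zero, ← finsum_comp_equiv (Equiv.neg ℤ)]
  refine finsum_congr fun j => ?_
  simp only [Equiv.neg_apply]
  have h1 := h (c + s + K * j)
  rw [show 2 * c + s - (c + s + K * j) = c + K * -j by ring] at h1
  have h2 : q ^ (-j * ((2 * -j + 1) * K - 2 * s))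
      = q ^ ((2 * j + 1) * (K * j + s) - (c + s + K * j)) * q ^ (c + K * -j) := by
    rw [← zpow_add₀ hq.1]; congr 1; ring
  have h3 : q ^ ((2 * j + 1) * (K * j + s))
      = q ^ ((2 * j + 1) * (K * j + s) - (c + s + K * j)) * q ^ (c + s + K * j) := by
    rw [← zpow_add₀ hq.1]; congr 1; ring
  rw [h2, h3, mul_assoc, mul_assoc, h1]

lemma EE_BS (hq : Gen q) (ν p L : ℕ) : BS (EE q ν p L) :=
  BS_of _ (EE_supp hq ν p L)

lemma AA_BS (hq : Gen q) (ν c L : ℕ) : BS (AA q ν c L) :=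
  BS_of _ (AA_supp hq ν c L)

lemma BS_refl {f : ℤ → F} (hf : BS f) (N : ℤ) : BS (fun a => f (N - a)) := by
  have := BS_comp hf (show (-1 : ℤ) ≠ 0 by norm_num) N (fun _ => 1)
  simpa [BS, sub_eq_add_neg] using this

lemma BS_shift {f : ℤ → F} (hf : BS f) (N : ℤ) : BS (fun a => f (a - N)) := by
  have := BS_comp hf (show (1 : ℤ) ≠ 0 by norm_num) (-N) (fun _ => 1)
  simpa [BS, sub_eq_add_neg, add_comm] using this

lemma BS_mul {f : ℤ → F} (hf : BS f) (w : ℤ → F) : BS (fun a => w a * f a) := by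
  have := BS_comp hf (show (1 : ℤ) ≠ 0 by norm_num) 0 w
  simpa [BS] using this

lemma WW_AA_succ (hq : Gen q) (ν L r : ℕ) (hr : r ≤ ν) {K : ℤ} (hK : K ≠ 0) (s c : ℤ) :
    WW q K s c (AA q ν (r + 1) L)
      = WW q K (K - s) (ν * L + r - 1 - c) (AA q ν r L)
        + q ^ ((r : ℤ) * L) * WW q K s (c - r) (EE q ν r L) := by
  have h1 : AA q ν (r + 1) L = fun a => (fun a => AA q ν r L (ν * L + r - 1 - a)) a
      + (fun a => q ^ ((r : ℤ) * L) * EE q ν r L (a - r)) a := by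
    funext a
    rw [AA_succ, (sym_all hq ν L).2 r (by omega) a]
  rw [h1, WW_add hK _ _ (BS_refl (AA_BS hq ν r L) _)
    (BS_mul (BS_shift (EE_BS hq ν r L) r) _), WW_refl,
    WW_smul, WW_shift]

lemma WW_EE_succ (hq : Gen q) (ν L b r : ℕ) (hbr : b + r = ν) {K : ℤ} (hK : K ≠ 0) (s c : ℤ)
    (hc : 2 * c + s = ν * ((L : ℤ) + 1) + r + 1) :
    WW q K s c (EE q ν b (L + 1)) = WW q K s c (AA q ν (r + 1) L) := by
  have h1 : EE q ν b (L + 1) = fun a => (AA q ν (r + 1) L) a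
      + (fun a => q ^ ((r : ℤ) * ((L : ℤ) + 1) - a) * AA q ν b L (a - (r + 1))) a := by
    funext a
    rw [EE_rec hq ν L b r hbr a, sub_sub]
  have hν : (ν : ℤ) = b + r := by rw [← hbr]; push_cast; ring
  have hv : WW q K s c (fun a => q ^ ((r : ℤ) * ((L : ℤ) + 1) - a) * AA q ν b L (a - (r + 1)))
      = 0 := by
    apply WW_vanish hq
    intro a
    beta_reduce
    rw [← mul_assoc, ← mul_assoc, ← zpow_add₀ hq.1, ← zpow_add₀ hq.1,
      (sym_all hq ν L).2 b (by omega) (a - (r + 1)), hc]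
    congr 2
    · ring
    · rw [hν]; ring
  rw [h1, WW_add hK _ _ (AA_BS hq _ _ _) (BS_mul (BS_shift (AA_BS hq ν b L) _) _), hv, add_zero]

/-! ### From `W` to the functional -/

lemma W_eq_WW (hq : Gen q) (ν L b : ℕ) (hb : b ≤ ν) (s c : ℤ)
    (hc : 2 * c = ν * ((L : ℤ) + 1) - s - b + 1) :
    W ν s b L q = WW q (2 * ν + 3) s c (EE q ν b L) := by
  have hK : (2 * (ν : ℤ) + 3) ≠ 0 := by omega
  unfold W WW
  generalize (ν : ℤ) * ((L : ℤ) + 1) = N at hc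
  have h1 : (N - s - b + 1) / 2 = c := by omega
  have h2 : (N + s - b + 1) / 2 = c + s := by omega
  rw [h1, h2]
  simp only [qMulti_eq hq ν b hb]
  exact finsum_sub_distrib (BS_comp (EE_BS hq ν b L) hK c _)
    (BS_comp (EE_BS hq ν b L) hK (c + s) _)

/-! ### Gordon paths -/

/-- the finite set of Gordon paths -/
def GS (ν s0 : ℕ) : ℕ → ℕ → Finset (ℕ → ℕ)
  | 0, b => if s0 = b then {fun k => if k = 0 then s0 else 0} else ∅
  | L + 1, b => (Finset.range (ν - b + 1)).biUnion fun m =>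
      (GS ν s0 L m).image fun f => Function.update f (L + 1) b

lemma mem_GS (ν s0 : ℕ) : ∀ (L b : ℕ), b ≤ ν → ∀ f : ℕ → ℕ,
    f ∈ GS ν s0 L b ↔ IsGordon ν L s0 b f := by
  intro L
  induction L with
  | zero =>
    intro b hb f
    unfold GS IsGordon
    constructor
    · intro hf
      split_ifs at hf with h
      · rw [Finset.mem_singleton] at hf
        subst hf
        refine ⟨by simp, by simp [h], by simp, ?_⟩
        intro k hk
        simp [hk.ne']
      · simp at hf
    · rintro ⟨h1, h2, -, h4⟩
      rw [if_pos (h1.symm.trans h2), Finset.mem_singleton]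
      funext k
      split_ifs with hk
      · rw [hk, h1]
      · exact h4 k (by omega)
  | succ L ih =>
    intro b hb f
    simp only [GS, Finset.mem_biUnion, Finset.mem_range, Finset.mem_image]
    constructor
    · rintro ⟨m, hm, g, hg, rfl⟩
      obtain ⟨h1, h2, h3, h4⟩ := (ih m (by omega) g).mp hg
      refine ⟨?_, by simp, ?_, ?_⟩
      · rw [Function.update_of_ne (by omega), h1]
      · intro k hk
        rw [Function.update_of_ne (by omega)]
        by_cases hkL : k = L
        · subst hkL
          rw [Function.update_self]
          omega
        · rw [Function.update_of_ne (by omega)]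
          exact h3 k (by omega)
      · intro k hk
        rw [Function.update_of_ne (by omega)]
        exact h4 k (by omega)
    · rintro ⟨h1, h2, h3, h4⟩
      have h5 := h3 L (by omega)
      refine ⟨f L, by omega, Function.update f (L + 1) 0, ?_, ?_⟩
      · rw [ih (f L) (by omega)]
        refine ⟨?_, ?_, ?_, ?_⟩
        · rw [Function.update_of_ne (by omega), h1]
        · rw [Function.update_of_ne (by omega)]
        · intro k hk
          rw [Function.update_of_ne (by omega), Function.update_of_ne (by omega)]
          exact h3 k (by omega)
        · intro k hk
          by_cases hkL : k = L + 1
          · rw [hkL, Function.update_self]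
          · rw [Function.update_of_ne hkL]
            exact h4 k (by omega)
      · rw [Function.update_idem, ← h2, Function.update_eq_self]

lemma G_eq_sum (ν s0 L b : ℕ) (hb : b ≤ ν) :
    G ν 0 (L : ℤ) s0 b q = ∑ f ∈ GS ν s0 L b, q ^ gwt 0 L f := by
  have hL : ((L : ℤ) - 0).toNat = L := by simp
  unfold G
  rw [hL, finsum_eq_sum_of_support_subset (s := GS ν s0 L b)]
  · refine Finset.sum_congr rfl fun f hf => ?_
    rw [if_pos ((mem_GS ν s0 L b hb f).mp hf)]
  · intro f hf
    rw [Finset.mem_coe, mem_GS ν s0 L b hb f]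
    by_contra h
    exact hf (if_neg h)

lemma gwt_eq (n : ℕ) (f : ℕ → ℕ) : gwt 0 n f = ∑ k ∈ Finset.range n, (k : ℤ) * (f k : ℤ) := by
  unfold gwt
  simp only [zero_add]
  refine Finset.sum_subset ?_ ?_
  · intro k hk
    rw [Finset.mem_Ioo] at hk
    exact Finset.mem_range.mpr hk.2
  · intro k hk hk'
    rw [Finset.mem_range] at hk
    rw [Finset.mem_Ioo] at hk'
    obtain rfl : k = 0 := by omega
    simp

lemma G_zero (ν s0 b : ℕ) (hb : b ≤ ν) :
    G ν 0 ((0 : ℕ) : ℤ) s0 b q = if s0 = b then 1 else 0 := by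
  rw [G_eq_sum ν s0 0 b hb]
  unfold GS
  split_ifs <;> simp [gwt]

lemma G_succ (hq : Gen q) (ν s0 L b : ℕ) (hb : b ≤ ν) :
    G ν 0 ((L + 1 : ℕ) : ℤ) s0 b q
      = ∑ m ∈ Finset.range (ν - b + 1), q ^ ((m : ℤ) * L) * G ν 0 (L : ℤ) s0 m q := by
  rw [G_eq_sum ν s0 (L + 1) b hb]
  simp only [GS]
  rw [Finset.sum_biUnion]
  · refine Finset.sum_congr rfl fun m hm => ?_
    have hm' := Finset.mem_range.mp hm
    rw [G_eq_sum ν s0 L m (by omega), Finset.sum_image, Finset.mul_sum]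
    · refine Finset.sum_congr rfl fun f hf => ?_
      obtain ⟨h1, h2, h3, h4⟩ := (mem_GS ν s0 L m (by omega) f).mp hf
      rw [← zpow_add₀ hq.1]
      congr 1
      rw [gwt_eq, gwt_eq, Finset.sum_range_succ, Function.update_of_ne (by omega), h2, add_comm]
      congr 1
      · ring
      · refine Finset.sum_congr rfl fun k hk => ?_
        have := Finset.mem_range.mp hk
        rw [Function.update_of_ne (by omega)]
    · intro f hf g hg hfg
      have h1 := ((mem_GS ν s0 L m (by omega) f).mp hf).2.2.2 (L + 1) (by omega)
      have h2 := ((mem_GS ν s0 L m (by omega) g).mp hg).2.2.2 (L + 1) (by omega)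
      funext k
      by_cases hk : k = L + 1
      · rw [hk, h1, h2]
      · have := congrFun hfg k
        simpa [Function.update_of_ne hk] using this
  · intro m hm m' hm' hne
    rw [Finset.mem_coe, Finset.mem_range] at hm hm'
    rw [Function.onFun, Finset.disjoint_left]
    intro f hf hf'
    rw [Finset.mem_image] at hf hf'
    obtain ⟨g, hg, rfl⟩ := hf
    obtain ⟨g', hg', he⟩ := hf'
    have h1 := ((mem_GS ν s0 L m (by omega) g).mp hg).2.1
    have h2 := ((mem_GS ν s0 L m' (by omega) g').mp hg').2.1
    have := congrFun he L
    rw [Function.update_of_ne (by omega), Function.update_of_ne (by omega)] at this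
    exact hne (by omega)

/-! ### The main induction -/

lemma WW_base (hq : Gen q) (ν b s : ℕ) (hs : s ≤ ν) (hb : b ≤ ν) (s' c : ℤ)
    (hs' : s' = s + 1 ∨ s' = 2 * ν + 3 - (s + 1)) (hc : 2 * c = ν - s' - b + 1) :
    WW q (2 * ν + 3) s' c (EE q ν b 0) = if ν - s = b then 1 else 0 := by
  have e0 : EE q ν b 0 = fun a => if a = 0 then 1 else 0 := by
    funext a; exact EE_L0 hq ν b a
  have nz : ∀ x j : ℤ, -(2 * (ν : ℤ) + 3) < x → x < 2 * ν + 3 → x + (2 * (ν : ℤ) + 3) * j = 0 →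
      j = 0 := by
    intro x j h1 h2 h3
    have h4 : (2 * (ν : ℤ) + 3) ∣ x := ⟨-j, by linarith⟩
    have h5 : x = 0 := Int.eq_zero_of_abs_lt_dvd h4 (abs_lt.mpr ⟨h1, h2⟩)
    have h6 : (2 * (ν : ℤ) + 3) * j = 0 := by linarith
    rcases mul_eq_zero.mp h6 with h | h
    · omega
    · exact h
  unfold WW
  rw [e0, finsum_eq_single _ (0 : ℤ), finsum_eq_single _ (0 : ℤ)]
  · beta_reduce
    rw [if_neg (show ¬ (c + s' + (2 * (ν : ℤ) + 3) * 0 = 0) by omega)]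
    simp only [mul_zero, zero_mul, zpow_zero, one_mul, add_zero, sub_zero]
    by_cases h : ν - s = b
    · rw [if_pos h, if_pos (by omega)]
    · rw [if_neg h, if_neg (by omega)]
  · intro j hj
    beta_reduce
    rw [if_neg (fun h => hj (nz _ j (by omega) (by omega) h)), mul_zero]
  · intro j hj
    beta_reduce
    rw [if_neg (fun h => hj (nz _ j (by omega) (by omega) h)), mul_zero]

lemma WW_zero (K s c : ℤ) (ν L : ℕ) : WW q K s c (AA q ν 0 L) = 0 := by
  simp [WW, AA]

lemma WW_AA_sum (hq : Gen q) (ν s L : ℕ) (g : ℕ → F)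
    (H : ∀ b : ℕ, b ≤ ν → ∀ s' c : ℤ, (s' = s + 1 ∨ s' = 2 * ν + 3 - (s + 1)) →
      2 * c = ν * ((L : ℤ) + 1) - s' - b + 1 → WW q (2 * ν + 3) s' c (EE q ν b L) = g b) :
    ∀ r : ℕ, r ≤ ν → ∀ s' c : ℤ, (s' = s + 1 ∨ s' = 2 * ν + 3 - (s + 1)) →
      2 * c + s' = ν * ((L : ℤ) + 1) + r + 1 →
      WW q (2 * ν + 3) s' c (AA q ν (r + 1) L)
        = ∑ m ∈ Finset.range (r + 1), q ^ ((m : ℤ) * L) * g m := by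
  have hK : (2 * (ν : ℤ) + 3) ≠ 0 := by omega
  intro r
  induction r with
  | zero =>
    intro hr s' c hs' hc
    rw [WW_AA_succ hq ν L 0 hr hK, WW_zero, H 0 hr s' _ hs' (by push_cast at hc ⊢; linarith)]
    simp
  | succ r ih =>
    intro hr s' c hs' hc
    rw [WW_AA_succ hq ν L (r + 1) hr hK,
      H (r + 1) hr s' _ hs' (by push_cast at hc ⊢; linarith),
      ih (by omega) _ _ (by omega) (by push_cast at hc ⊢; linarith),
      Finset.sum_range_succ _ (r + 1)]

lemma WW_main (hq : Gen q) (ν s : ℕ) (hs : s ≤ ν) (L : ℕ) :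
    ∀ b : ℕ, b ≤ ν → ∀ s' c : ℤ, (s' = s + 1 ∨ s' = 2 * ν + 3 - (s + 1)) →
      2 * c = ν * ((L : ℤ) + 1) - s' - b + 1 →
      WW q (2 * ν + 3) s' c (EE q ν b L) = G ν 0 (L : ℤ) (ν - s) b q := by
  have hK : (2 * (ν : ℤ) + 3) ≠ 0 := by omega
  induction L with
  | zero =>
    intro b hb s' c hs' hc
    rw [G_zero _ _ _ hb]
    exact WW_base hq ν b s hs hb s' c hs' (by push_cast at hc; linarith)
  | succ L ih =>
    intro b hb s' c hs' hc
    have hbr : b + (ν - b) = ν := by omega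
    have hc' : 2 * c + s' = ν * ((L : ℤ) + 1) + ((ν - b : ℕ) : ℤ) + 1 := by
      rw [Nat.cast_sub hb]
      push_cast at hc
      linarith
    rw [G_succ hq _ _ _ _ hb, WW_EE_succ hq ν L b (ν - b) hbr hK s' c hc']
    exact WW_AA_sum hq ν s L _ ih (ν - b) (by omega) s' c hs' hc'

lemma Gen_X : Gen (RatFunc.X : RatFunc ℚ) := by
  refine ⟨RatFunc.X_ne_zero, fun n h => ?_⟩
  have h1 : algebraMap (Polynomial ℚ) (RatFunc ℚ) (1 - Polynomial.X ^ (n + 1)) = 0 := by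
    simpa using h
  have h2 : (1 - Polynomial.X ^ (n + 1) : Polynomial ℚ) = 0 :=
    RatFunc.algebraMap_injective ℚ (by rw [h1, map_zero])
  have h3 := congrArg (Polynomial.eval 0) h2
  simp at h3

end Aux

theorem stmt_11 (ν : ℕ) (hν : 1 ≤ ν) (s b : ℕ) (hs : s ≤ ν) (hb : b ≤ ν) (L : ℕ) :
    (((b : ℤ) + s ≡ (ν : ℤ) * ((L : ℤ) + 1) [ZMOD 2]) →
      G ν 0 (L : ℤ) (ν - s) b (RatFunc.X : K) = W ν ((s : ℤ) + 1) b L RatFunc.X) ∧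
    (¬ ((b : ℤ) + s ≡ (ν : ℤ) * ((L : ℤ) + 1) [ZMOD 2]) →
      G ν 0 (L : ℤ) (ν - s) b (RatFunc.X : K) = W ν (2 * (ν : ℤ) + 2 - s) b L RatFunc.X) := by
  constructor
  · intro h
    have h' : ((b : ℤ) + s) % 2 = ((ν : ℤ) * ((L : ℤ) + 1)) % 2 := h
    obtain ⟨c, hc⟩ : ∃ c : ℤ, 2 * c = ν * ((L : ℤ) + 1) - ((s : ℤ) + 1) - b + 1 := by
      generalize (ν : ℤ) * ((L : ℤ) + 1) = N at h' ⊢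
      exact ⟨(N - (s + 1) - b + 1) / 2, by omega⟩
    rw [W_eq_WW Gen_X ν L b hb _ c hc, WW_main Gen_X ν s hs L b hb _ c (Or.inl rfl) hc]
  · intro h
    have h' : ¬ ((b : ℤ) + s) % 2 = ((ν : ℤ) * ((L : ℤ) + 1)) % 2 := h
    obtain ⟨c, hc⟩ : ∃ c : ℤ, 2 * c = ν * ((L : ℤ) + 1) - (2 * (ν : ℤ) + 2 - s) - b + 1 := by
      generalize (ν : ℤ) * ((L : ℤ) + 1) = N at h' ⊢
      exact ⟨(N - (2 * (ν : ℤ) + 2 - s) - b + 1) / 2, by omega⟩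
    rw [W_eq_WW Gen_X ν L b hb _ c hc,
      WW_main Gen_X ν s hs L b hb _ c (Or.inr (by ring)) hc]

end
end
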